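/- arXiv:1211.2374 — 10 statements merged into one kernel-verified Lean document; each statement's English description precedes it below -/
import Mathlib

section
/- Every infinite, connected, locally finite, vertex-transitive simple graph has a perfect matching (a set of edges, no two sharing a vertex, covering every vertex). -/
open scoped Classical

namespace PaperPM

variable {V : Type*}

/-- `M` is a perfect matching of `G`: a set of edges of `G`, no two sharing a vertex,
covering every vertex; equivalently, every vertex lies in exactly one edge of `M`. -/
def IsPerfectMatching (G : SimpleGraph V) (M : Set (Sym2 V)) : Prop :=
  M ⊆ G.edgeSet ∧ ∀ v : V, ∃! e, e ∈ M ∧ v ∈ e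

noncomputable def cut (N : V → Finset V) (A : Finset V) : ℕ := ∑ a ∈ A, (N a \ A).card

theorem cut_submod (N : V → Finset V) (A B : Finset V) :
    cut N (A ∩ B) + cut N (A ∪ B) ≤ cut N A + cut N B := by
  have key : ∀ C ⊆ A ∪ B, cut N C = ∑ x ∈ A ∪ B, if x ∈ C then (N x \ C).card else 0 := by
    intro C hC
    rw [← Finset.sum_filter, Finset.filter_mem_eq_inter, Finset.inter_eq_right.2 hC, cut]
  rw [key (A ∩ B) (Finset.inter_subset_left.trans Finset.subset_union_left),
    key (A ∪ B) subset_rfl, key A Finset.subset_union_left, key B Finset.subset_union_right,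
    ← Finset.sum_add_distrib, ← Finset.sum_add_distrib]
  apply Finset.sum_le_sum
  intro x hx
  have h1 : (N x \ (A ∪ B)).card ≤ (N x \ A).card :=
    Finset.card_le_card (Finset.sdiff_subset_sdiff subset_rfl Finset.subset_union_left)
  have h2 : (N x \ (A ∪ B)).card ≤ (N x \ B).card :=
    Finset.card_le_card (Finset.sdiff_subset_sdiff subset_rfl Finset.subset_union_right)
  have h3 : (N x \ (A ∩ B)).card + (N x \ (A ∪ B)).card = (N x \ A).card + (N x \ B).card := by
    rw [show N x \ (A ∩ B) = (N x \ A) ∪ (N x \ B) by ext; simp; tauto,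
      show N x \ (A ∪ B) = (N x \ A) ∩ (N x \ B) by ext; simp; tauto]
    exact Finset.card_union_add_card_inter _ _
  by_cases hA : x ∈ A <;> by_cases hB : x ∈ B <;> simp [hA, hB] <;> omega

theorem exists_edge_out [Infinite V] (G : SimpleGraph V) (hconn : G.Connected)
    (A : Finset V) (hA : A.Nonempty) : ∃ x ∈ A, ∃ y ∉ A, G.Adj x y := by
  obtain ⟨x, hx⟩ := hA
  obtain ⟨y, hy⟩ := Infinite.exists_notMem_finset A
  obtain ⟨p⟩ := hconn.preconnected x y
  obtain ⟨d, -, h1, h2⟩ := p.exists_boundary_dart (A : Set V) hx hy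
  exact ⟨d.fst, h1, d.snd, h2, d.adj⟩

theorem map_N (G : SimpleGraph V) (N : V → Finset V)
    (hN : ∀ v w, w ∈ N v ↔ G.Adj v w) (φ : G ≃g G) (x : V) :
    N (φ x) = (N x).map φ.toEquiv.toEmbedding := by
  ext w
  simp only [Finset.mem_map, hN]
  constructor
  · intro h
    refine ⟨φ.symm w, ?_, by simp⟩
    rw [← φ.map_adj_iff]; simpa using h
  · rintro ⟨a, ha, rfl⟩
    exact φ.map_adj_iff.2 ha

theorem card_sdiff_map (G : SimpleGraph V) (N : V → Finset V)
    (hN : ∀ v w, w ∈ N v ↔ G.Adj v w) (φ : G ≃g G) (x : V) (A : Finset V) :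
    (N (φ x) \ A.map φ.toEquiv.toEmbedding).card = (N x \ A).card := by
  rw [map_N G N hN, ← Finset.map_sdiff, Finset.card_map]

theorem cut_map (G : SimpleGraph V) (N : V → Finset V)
    (hN : ∀ v w, w ∈ N v ↔ G.Adj v w) (φ : G ≃g G) (A : Finset V) :
    cut N (A.map φ.toEquiv.toEmbedding) = cut N A := by
  unfold cut
  rw [Finset.sum_map]
  exact Finset.sum_congr rfl fun x _ => card_sdiff_map G N hN φ x A

theorem exists_atom [Nonempty V] (N : V → Finset V) : ∃ A : Finset V, A.Nonempty ∧
    (∀ B : Finset V, B.Nonempty → cut N A ≤ cut N B) ∧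
    ∀ B : Finset V, B.Nonempty → cut N B ≤ cut N A → A.card ≤ B.card := by
  have h1 : ∃ k, ∃ A : Finset V, A.Nonempty ∧ cut N A = k :=
    ⟨_, {Classical.arbitrary V}, by simp, rfl⟩
  have h2 : ∃ m, ∃ A : Finset V, A.Nonempty ∧ cut N A = Nat.find h1 ∧ A.card = m := by
    obtain ⟨A, hA, h⟩ := Nat.find_spec h1
    exact ⟨_, A, hA, h, rfl⟩
  obtain ⟨A, hA, hc, hm⟩ := Nat.find_spec h2
  refine ⟨A, hA, fun B hB => ?_, fun B hB hle => ?_⟩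
  · rw [hc]; exact Nat.find_min' h1 ⟨B, hB, rfl⟩
  · rw [hm]
    refine Nat.find_min' h2 ⟨B, hB, le_antisymm (hle.trans hc.le) ?_, rfl⟩
    exact Nat.find_min' h1 ⟨B, hB, rfl⟩

theorem cut_ge [Infinite V] (G : SimpleGraph V) (N : V → Finset V)
    (hN : ∀ v w, w ∈ N v ↔ G.Adj v w) (hconn : G.Connected)
    (htrans : ∀ x y : V, ∃ φ : G ≃g G, φ x = y) (v : V)
    (B : Finset V) (hB : B.Nonempty) : (N v).card ≤ cut N B := by
  obtain ⟨A, ⟨x, hx⟩, hmin, hcard⟩ := exists_atom N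
  refine le_trans ?_ (hmin B hB)
  have hv : (N v).card = (N x).card := by
    obtain ⟨φ, rfl⟩ := htrans x v
    rw [map_N G N hN, Finset.card_map]
  have hstab : ∀ y ∈ A, (N y \ A).card = (N x \ A).card := by
    intro y hy
    obtain ⟨φ, rfl⟩ := htrans x y
    set A' := A.map φ.toEquiv.toEmbedding with hA'
    have hc : cut N A' = cut N A := cut_map G N hN φ A
    have hne : (A ∩ A').Nonempty := ⟨φ x, by
      rw [Finset.mem_inter]; exact ⟨hy, Finset.mem_map_of_mem φ.toEquiv.toEmbedding hx⟩⟩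
    have hs := cut_submod N A A'
    have hu := hmin (A ∪ A') ⟨x, Finset.mem_union_left _ hx⟩
    have hle := hcard (A ∩ A') hne (by omega)
    have e1 : A ∩ A' = A := Finset.eq_of_subset_of_card_le Finset.inter_subset_left hle
    have e2 : A = A' := Finset.eq_of_subset_of_card_le (Finset.inter_eq_left.1 e1)
      (by rw [hA', Finset.card_map])
    have := card_sdiff_map G N hN φ x A
    rwa [← hA', ← e2] at this
  have hcut : cut N A = A.card * (N x \ A).card := by
    unfold cut
    rw [Finset.sum_congr rfl hstab, Finset.sum_const, smul_eq_mul]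
  obtain ⟨a, ha, b, hb, hab⟩ := exists_edge_out G hconn A ⟨x, hx⟩
  have hc1 : 1 ≤ (N x \ A).card := by
    rw [← hstab a ha]
    exact Finset.card_pos.2 ⟨b, by simp [hN, hab, hb]⟩
  have hsplit : (N x ∩ A).card + (N x \ A).card = (N x).card := Finset.card_inter_add_card_sdiff _ _
  have hr : (N x ∩ A).card + 1 ≤ A.card := by
    have : (N x ∩ A).card < A.card := Finset.card_lt_card
      ⟨Finset.inter_subset_right, fun h => by
        have := h hx
        simp [hN] at this⟩
    omega
  rw [hv, hcut]
  nlinarith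

theorem tutte_count (G : SimpleGraph V) (N : V → Finset V)
    (hN : ∀ v w, w ∈ N v ↔ G.Adj v w) (d : ℕ) (hd : 0 < d) (hreg : ∀ v, (N v).card = d)
    (hcut : ∀ B : Finset V, B.Nonempty → d ≤ cut N B)
    {ι : Type*} (I : Finset ι) (F : ι → Finset V) (S : Finset V)
    (hne : ∀ i ∈ I, (F i).Nonempty)
    (hdisj : (I : Set ι).PairwiseDisjoint F)
    (hsub : ∀ i ∈ I, ∀ x ∈ F i, ∀ y, G.Adj x y → y ∈ F i ∨ y ∈ S) : I.card ≤ S.card := by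
  have h1 : I.card * d ≤ ∑ i ∈ I, ∑ x ∈ F i, (N x ∩ S).card := by
    rw [← smul_eq_mul, ← Finset.sum_const]
    refine Finset.sum_le_sum fun i hi => (hcut _ (hne i hi)).trans ?_
    refine Finset.sum_le_sum fun x hx => Finset.card_le_card fun y hy => ?_
    rw [Finset.mem_sdiff, hN] at hy
    have := hsub i hi x hx y hy.1
    simp only [Finset.mem_inter, hN]
    tauto
  have h2 : ∑ i ∈ I, ∑ x ∈ F i, (N x ∩ S).card = ∑ x ∈ I.biUnion F, (N x ∩ S).card :=
    (Finset.sum_biUnion hdisj).symm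
  have h3 : ∑ x ∈ I.biUnion F, (N x ∩ S).card = ∑ s ∈ S, (N s ∩ I.biUnion F).card := by
    have := Finset.sum_card_bipartiteAbove_eq_sum_card_bipartiteBelow
      (s := I.biUnion F) (t := S) G.Adj
    convert this using 2 with x hx x hx
    · congr 1; ext y; simp [Finset.bipartiteAbove, hN, and_comm]
    · congr 1; ext y; simp only [Finset.bipartiteBelow, hN, Finset.mem_inter, Finset.mem_filter,
        and_comm, G.adj_comm]
  have h4 : ∑ s ∈ S, (N s ∩ I.biUnion F).card ≤ S.card * d := by
    rw [← smul_eq_mul, ← Finset.sum_const]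
    exact Finset.sum_le_sum fun s _ => (Finset.card_le_card Finset.inter_subset_left).trans (hreg s).le
  exact Nat.le_of_mul_le_mul_right (by omega : I.card * d ≤ S.card * d) hd

theorem compactness (N : V → Finset V)
    (h : ∀ X : Finset V, ∃ f : V → V, (∀ v, f v ∈ N v) ∧ ∀ v ∈ X, f (f v) = v) :
    ∃ g : V → V, (∀ v, g v ∈ N v) ∧ ∀ v, g (g v) = v := by
  choose f hf1 hf2 using h
  let U : Ultrafilter (Finset V) := Ultrafilter.of Filter.atTop
  have hU : (U : Filter (Finset V)) ≤ Filter.atTop := Ultrafilter.of_le _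
  have key : ∀ v, ∃ w ∈ N v, ∀ᶠ X in (U : Filter (Finset V)), f X v = w := by
    intro v
    have : (⋃ w ∈ (N v : Set V), {X | f X v = w}) ∈ U := by
      have e : (⋃ w ∈ (N v : Set V), {X | f X v = w}) = Set.univ := by
        ext X; simp [hf1]
      rw [e]; exact Filter.univ_mem
    obtain ⟨w, hw, h⟩ := (Ultrafilter.finite_biUnion_mem_iff (N v).finite_toSet).1 this
    exact ⟨w, hw, h⟩
  choose g hg1 hg2 using key
  refine ⟨g, hg1, fun v => ?_⟩
  have h3 : ∀ᶠ X in (U : Filter (Finset V)), {v} ≤ X := hU (Filter.eventually_ge_atTop _)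
  obtain ⟨X, ha, hb, hc⟩ := ((hg2 v).and ((hg2 (g v)).and h3)).exists
  have := hf2 X v (by simpa using hc)
  rw [ha, hb] at this
  exact this

theorem finite_step.{u} {V : Type u} [Infinite V] (G : SimpleGraph V) (N : V → Finset V)
    (hN : ∀ v w, w ∈ N v ↔ G.Adj v w) (hne : ∀ v, (N v).Nonempty)
    (hT : ∀ {ι : Type u} (I : Finset ι) (F : ι → Finset V) (S : Finset V),
      (∀ i ∈ I, (F i).Nonempty) → ((I : Set ι).PairwiseDisjoint F) →
      (∀ i ∈ I, ∀ x ∈ F i, ∀ y, G.Adj x y → y ∈ F i ∨ y ∈ S) → I.card ≤ S.card)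
    (X : Finset V) : ∃ f : V → V, (∀ v, f v ∈ N v) ∧ ∀ v ∈ X, f (f v) = v := by
  obtain ⟨Y, hXY, hNY, hev⟩ : ∃ Y : Finset V, X ⊆ Y ∧ (∀ x ∈ X, N x ⊆ Y) ∧ Even Y.card := by
    let Y0 := X ∪ X.biUnion N
    have h0 : X ⊆ Y0 := Finset.subset_union_left
    have h1 : ∀ x ∈ X, N x ⊆ Y0 := fun x hx =>
      (Finset.subset_biUnion_of_mem N hx).trans Finset.subset_union_right
    by_cases he : Even Y0.card
    · exact ⟨Y0, h0, h1, he⟩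
    · obtain ⟨z, hz⟩ := Infinite.exists_notMem_finset Y0
      refine ⟨insert z Y0, h0.trans (Finset.subset_insert _ _),
        fun x hx => (h1 x hx).trans (Finset.subset_insert _ _), ?_⟩
      rw [Finset.card_insert_of_notMem hz, Nat.even_add_one]
      exact he
  let H : SimpleGraph Y :=
    { Adj := fun a b => G.Adj a b ∨ (a ≠ b ∧ (a : V) ∉ X ∧ (b : V) ∉ X)
      symm := ⟨fun a b h => by
        rcases h with h | ⟨h1, h2, h3⟩
        · exact Or.inl h.symm
        · exact Or.inr ⟨h1.symm, h3, h2⟩⟩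
      loopless := ⟨fun a h => by simp at h⟩ }
  have hH : ∀ a b : Y, H.Adj a b ↔ (G.Adj a b ∨ (a ≠ b ∧ (a : V) ∉ X ∧ (b : V) ∉ X)) :=
    fun _ _ => Iff.rfl
  have hM : ∃ M : H.Subgraph, M.IsPerfectMatching := by
    rw [SimpleGraph.tutte]
    intro u hu
    rw [SimpleGraph.IsTutteViolator] at hu
    set K := ((⊤ : H.Subgraph).deleteVerts u).coe with hK
    have hKadj : ∀ a b, K.Adj a b ↔ H.Adj a.1 b.1 := by
      intro a b
      have ha := a.2
      have hb := b.2
      simp only [SimpleGraph.Subgraph.deleteVerts_verts] at ha hb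
      simp [hK, ha.2, hb.2]
    have hcardW : Odd K.oddComponents.ncard ↔ Odd (Y.card - u.ncard) := by
      rw [SimpleGraph.odd_ncard_oddComponents]
      have : Nat.card ((⊤ : H.Subgraph).deleteVerts u).verts = Y.card - u.ncard := by
        rw [Nat.card_coe_set_eq, SimpleGraph.Subgraph.deleteVerts_verts,
          SimpleGraph.Subgraph.verts_top, Set.ncard_sdiff (Set.subset_univ _), Set.ncard_univ]
        simp
      rw [this]
    have hule : u.ncard ≤ Y.card := by
      have := Set.ncard_le_ncard (Set.subset_univ u)
      rw [Set.ncard_univ] at this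
      simpa using this
    let F : K.ConnectedComponent → Finset V := fun c =>
      (Set.toFinite ((fun a => (a.1 : V)) '' c.supp)).toFinset
    have hF : ∀ c x, x ∈ F c ↔ ∃ a ∈ c.supp, (a.1 : V) = x := by
      intro c x; simp only [F, Set.Finite.mem_toFinset, Set.mem_image]
    let I : Set K.ConnectedComponent := {c | ∀ a ∈ c.supp, (a.1 : V) ∈ X}
    let S : Finset V := (Set.toFinite ((fun a : Y => (a : V)) '' u)).toFinset
    have hScard : S.card = u.ncard := by
      rw [← Set.ncard_eq_toFinset_card _ (Set.toFinite _), Set.ncard_image_of_injective _ Subtype.val_injective]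
    have hI : I.ncard ≤ u.ncard := by
      rw [Set.ncard_eq_toFinset_card I (Set.toFinite I), ← hScard]
      refine hT _ F S ?_ ?_ ?_
      · intro c _
        obtain ⟨a, ha⟩ := c.nonempty_supp
        exact ⟨a.1, (hF _ _).2 ⟨a, ha, rfl⟩⟩
      · intro c _ c' _ hcc
        rw [Function.onFun, Finset.disjoint_left]
        intro x hx hx'
        obtain ⟨a, ha, rfl⟩ := (hF _ _).1 hx
        obtain ⟨b, hb, hab⟩ := (hF _ _).1 hx'
        have : b = a := Subtype.ext (Subtype.ext hab)
        subst this
        exact hcc (SimpleGraph.ConnectedComponent.eq_of_common_vertex ha hb)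
      · intro c hc x hx y hxy
        rw [Set.Finite.mem_toFinset] at hc
        obtain ⟨a, ha, rfl⟩ := (hF _ _).1 hx
        have hyY : y ∈ Y := hNY _ (hc a ha) ((hN _ _).2 hxy)
        by_cases hyu : (⟨y, hyY⟩ : Y) ∈ u
        · right
          simp only [S, Set.Finite.mem_toFinset, Set.mem_image]
          exact ⟨_, hyu, rfl⟩
        · left
          rw [hF]
          refine ⟨⟨⟨y, hyY⟩, by simp [hyu]⟩, ?_, rfl⟩
          refine SimpleGraph.ConnectedComponent.mem_supp_of_adj_mem_supp _ ha ?_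
          rw [hKadj, hH]
          exact Or.inl hxy
    have hJ : Iᶜ.ncard ≤ 1 := by
      rw [Set.ncard_le_one_iff]
      intro c c' hc hc'
      simp only [I, Set.mem_compl_iff, Set.mem_ofPred_eq, not_forall] at hc hc'
      obtain ⟨a, ha, haX⟩ := hc
      obtain ⟨b, hb, hbX⟩ := hc'
      by_cases hab : a = b
      · subst hab
        exact SimpleGraph.ConnectedComponent.eq_of_common_vertex ha hb
      · have : K.Adj a b := by
          rw [hKadj, hH]
          exact Or.inr ⟨fun h => hab (Subtype.ext h), haX, hbX⟩
        exact SimpleGraph.ConnectedComponent.eq_of_common_vertex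
          (SimpleGraph.ConnectedComponent.mem_supp_of_adj_mem_supp _ ha this) hb
    have hle : K.oddComponents.ncard ≤ u.ncard + 1 := by
      have h1 : K.oddComponents.ncard ≤ (I ∪ Iᶜ).ncard :=
        Set.ncard_le_ncard (by simp) (Set.toFinite _)
      have h2 := Set.ncard_union_le I Iᶜ
      omega
    have heq : K.oddComponents.ncard = u.ncard + 1 := le_antisymm hle hu
    rw [heq, Nat.odd_iff, Nat.odd_iff] at hcardW
    rw [Nat.even_iff] at hev
    omega
  obtain ⟨M, hM⟩ := hM
  rw [SimpleGraph.Subgraph.isPerfectMatching_iff] at hM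
  choose m hm1 hm2 using hM
  have hmm : ∀ y, m (m y) = y := fun y => (hm2 _ _ (hm1 y).symm).symm
  choose n hn using hne
  let f : V → V := fun v => if h : ∃ hv : v ∈ Y, G.Adj v (m ⟨v, hv⟩) then m ⟨v, h.1⟩ else n v
  refine ⟨f, fun v => ?_, fun v hv => ?_⟩
  · by_cases h : ∃ hv : v ∈ Y, G.Adj v (m ⟨v, hv⟩)
    · simp only [f, dif_pos h, hN]; exact h.2
    · simp only [f, dif_neg h, hn]
  · have hvY := hXY hv
    have hadj : G.Adj v (m ⟨v, hvY⟩) := by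
      have := (hm1 ⟨v, hvY⟩).adj_sub
      rw [hH] at this
      rcases this with h | ⟨-, h, -⟩
      · exact h
      · exact absurd hv h
    have e1 : f v = m ⟨v, hvY⟩ := by
      have h : ∃ hv : v ∈ Y, G.Adj v (m ⟨v, hv⟩) := ⟨hvY, hadj⟩
      simp only [f, dif_pos h]
    rw [e1]
    have h : ∃ hv' : (m ⟨v, hvY⟩ : V) ∈ Y, G.Adj (m ⟨v, hvY⟩ : V) (m ⟨(m ⟨v, hvY⟩ : V), hv'⟩) :=
      ⟨(m ⟨v, hvY⟩).2, by
        have := hmm ⟨v, hvY⟩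
        simp only [Subtype.coe_eta, this]; exact hadj.symm⟩
    simp only [f, dif_pos h]
    simp only [Subtype.coe_eta, hmm]

/-- Every infinite, connected, locally finite, vertex-transitive simple graph has a
perfect matching. -/
theorem every_infinite_vertex_transitive_graph_has_perfect_matching
    {V : Type*} [Infinite V] (G : SimpleGraph V)
    (hconn : G.Connected)
    (hlocfin : ∀ v : V, (G.neighborSet v).Finite)
    (htrans : ∀ x y : V, ∃ φ : G ≃g G, φ x = y) :
    ∃ M : Set (Sym2 V), IsPerfectMatching G M := by
  let N : V → Finset V := fun v => (hlocfin v).toFinset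
  have hN : ∀ v w, w ∈ N v ↔ G.Adj v w := fun v w => by simp [N]
  have hne : ∀ v, (N v).Nonempty := by
    intro v
    obtain ⟨x, hx, y, -, h⟩ := exists_edge_out G hconn {v} (by simp)
    rw [Finset.mem_singleton] at hx
    exact ⟨y, by rw [hN, ← hx]; exact h⟩
  obtain ⟨v0⟩ : Nonempty V := inferInstance
  have hreg : ∀ v, (N v).card = (N v0).card := by
    intro v
    obtain ⟨φ, rfl⟩ := htrans v0 v
    rw [map_N G N hN, Finset.card_map]
  obtain ⟨g, hg1, hg2⟩ := compactness N (finite_step G N hN hne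
    (fun I F S h1 h2 h3 => tutte_count G N hN _ (Finset.card_pos.2 (hne v0)) hreg
      (cut_ge G N hN hconn htrans v0) I F S h1 h2 h3))
  refine ⟨Set.range fun v => s(v, g v), ?_, fun v => ⟨s(v, g v), ⟨⟨v, rfl⟩, by simp⟩, ?_⟩⟩
  · rintro _ ⟨v, rfl⟩
    exact (hN _ _).1 (hg1 v)
  · rintro _ ⟨⟨w, rfl⟩, hw⟩
    simp only [Sym2.mem_iff] at hw
    rcases hw with rfl | rfl
    · rfl
    · simp only [hg2]; exact Sym2.eq_swap

end PaperPM
end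

section
/- Let d ≥ 1 and let G be a finite d-regular simple graph on vertex set V such that every subset H ⊆ V of odd cardinality has at least d edges between H and V \ H. Then G has a perfect matching. -/
open scoped Classical

namespace PaperPM

variable {V : Type*}

/-- The set of edges of `G` with one endpoint in `A` and the other outside `A`. -/
def cutEdges (G : SimpleGraph V) (A : Set V) : Set (Sym2 V) :=
  {e | e ∈ G.edgeSet ∧ ∃ u v : V, e = s(u, v) ∧ u ∈ A ∧ v ∉ A}

theorem cut_aux {V : Type*} (G : SimpleGraph V) (u : Set V)
    (c : ((⊤ : G.Subgraph).deleteVerts u).coe.ConnectedComponent) (e : Sym2 V)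
    (he : e ∈ cutEdges G (Subtype.val '' c.supp)) :
    ∃ (a : ((⊤ : G.Subgraph).deleteVerts u).verts) (x : V),
      e = s(a.1, x) ∧ G.Adj a.1 x ∧ x ∈ u ∧ a ∈ c.supp := by
  obtain ⟨hG, _, x, rfl, ⟨a, ha, rfl⟩, hx⟩ := he
  have hadj : G.Adj a.1 x := hG
  refine ⟨a, x, rfl, hadj, ?_, ha⟩
  by_contra hxu
  apply hx
  refine ⟨⟨x, by simp [hxu]⟩, ?_, rfl⟩
  have hau : a.1 ∉ u := by have := a.2; simpa using this
  refine c.mem_supp_of_adj_mem_supp ha ?_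
  simp [hau, hxu, hadj]

/-- If `G` is a finite `d`-regular graph (`d ≥ 1`) in which every vertex set of odd
cardinality has at least `d` edges to its complement, then `G` has a perfect matching. -/
theorem perfect_matching_of_odd_cuts {V : Type*} [Fintype V]
    (d : ℕ) (hd : 1 ≤ d) (G : SimpleGraph V)
    (hreg : ∀ v : V, (G.neighborSet v).ncard = d)
    (hodd : ∀ H : Set V, Odd H.ncard → d ≤ (cutEdges G H).ncard) :
    ∃ M : Set (Sym2 V), IsPerfectMatching G M := by
  have hT : ∀ u, ¬ G.IsTutteViolator u := by
    intro u hu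
    unfold SimpleGraph.IsTutteViolator at hu
    set K := ((⊤ : G.Subgraph).deleteVerts u).coe with hK
    let F : K.ConnectedComponent → Finset (Sym2 V) :=
      fun c => (cutEdges G (Subtype.val '' c.supp)).toFinset
    have hF : ∀ c ∈ K.oddComponents.toFinset, d ≤ (F c).card := by
      intro c hc
      have hc' : Odd c.supp.ncard := by simpa using hc
      have := hodd (Subtype.val '' c.supp)
        (by rwa [Set.ncard_image_of_injective _ Subtype.val_injective])
      rwa [Set.ncard_eq_toFinset_card'] at this
    have hdisj : (K.oddComponents.toFinset : Set K.ConnectedComponent).PairwiseDisjoint F := by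
      intro c _ c' _ hne
      refine Finset.disjoint_left.2 fun e he he' => hne ?_
      obtain ⟨a, x, rfl, -, hx, ha⟩ := cut_aux G u c e (by simpa [F] using he)
      obtain ⟨b, y, hb, -, hy, hbc⟩ := cut_aux G u c' _ (by simpa [F] using he')
      have hau : a.1 ∉ u := by have := a.2; simpa using this
      rw [Sym2.eq_iff] at hb
      rcases hb with ⟨h1, -⟩ | ⟨h1, -⟩
      · have : a = b := Subtype.ext h1
        subst this
        exact (SimpleGraph.ConnectedComponent.mem_supp_iff _ _).1 ha ▸
          (SimpleGraph.ConnectedComponent.mem_supp_iff _ _).1 hbc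
      · exact absurd (h1 ▸ hy) hau
    have h1 : K.oddComponents.ncard * d ≤ (K.oddComponents.toFinset.biUnion F).card := by
      rw [Finset.card_biUnion hdisj, Set.ncard_eq_toFinset_card', ← smul_eq_mul]
      exact Finset.card_nsmul_le_sum _ _ _ hF
    have h2 : K.oddComponents.toFinset.biUnion F ⊆
        u.toFinset.biUnion fun x => G.incidenceFinset x := by
      intro e he
      obtain ⟨c, -, hc⟩ := Finset.mem_biUnion.1 he
      obtain ⟨a, x, rfl, hadj, hx, -⟩ := cut_aux G u c e (by simpa [F] using hc)
      refine Finset.mem_biUnion.2 ⟨x, by simpa using hx, ?_⟩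
      simp [SimpleGraph.incidenceSet, hadj]
    have h3 : (u.toFinset.biUnion fun x => G.incidenceFinset x).card ≤ u.ncard * d := by
      rw [Set.ncard_eq_toFinset_card']
      refine Finset.card_biUnion_le_card_mul _ _ _ fun x _ => ?_
      rw [SimpleGraph.card_incidenceFinset_eq_degree, ← hreg x, Set.ncard_eq_toFinset_card']
      rfl
    have h4 := h1.trans ((Finset.card_le_card h2).trans h3)
    exact absurd (Nat.le_of_mul_le_mul_right h4 hd) (not_le.2 hu)
  obtain ⟨M, hM⟩ := SimpleGraph.tutte.2 hT
  rw [SimpleGraph.Subgraph.isPerfectMatching_iff] at hM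
  refine ⟨M.edgeSet, M.edgeSet_subset, fun v => ?_⟩
  obtain ⟨w, hw, huniq⟩ := hM v
  refine ⟨s(v, w), ⟨hw, by simp⟩, ?_⟩
  rintro e ⟨he, hv⟩
  obtain ⟨y, rfl⟩ := Sym2.mem_iff_exists.1 hv
  rw [huniq y he]

end PaperPM
end

section
/- Let G be an infinite, connected, d-regular, vertex-transitive simple graph. Then the minimum, over all nonempty finite vertex sets A, of the number of edges between A and its complement equals d. -/
open scoped Classical

namespace PaperPM

variable {V : Type*}

def prs {V : Type*} (G : SimpleGraph V) (A : Set V) : Set (V × V) :=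
  {p | G.Adj p.1 p.2 ∧ p.1 ∈ A ∧ p.2 ∉ A}

lemma cut_eq {V : Type*} (G : SimpleGraph V) (A : Set V) :
    (cutEdges G A).ncard = (prs G A).ncard := by
  have h : cutEdges G A = (fun p : V × V => s(p.1, p.2)) '' prs G A := by
    ext e
    constructor
    · rintro ⟨he, u, v, rfl, hu, hv⟩
      exact ⟨(u, v), ⟨he, hu, hv⟩, rfl⟩
    · rintro ⟨⟨u, v⟩, ⟨he, hu, hv⟩, rfl⟩
      exact ⟨he, u, v, rfl, hu, hv⟩
  rw [h]
  apply Set.ncard_image_of_injOn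
  rintro ⟨u, v⟩ ⟨_, h1, h2⟩ ⟨a, b⟩ ⟨_, h3, h4⟩ h
  simp only [Sym2.eq_iff] at h
  rcases h with ⟨rfl, rfl⟩ | ⟨rfl, rfl⟩
  · rfl
  · exact absurd h1 h4

lemma prs_single {V : Type*} (G : SimpleGraph V) (x : V) :
    (prs G {x}).ncard = (G.neighborSet x).ncard := by
  have h : prs G {x} = (fun v => (x, v)) '' G.neighborSet x := by
    ext ⟨u, v⟩
    simp only [prs, Set.mem_ofPred_eq, Set.mem_singleton_iff, Set.mem_image,
      SimpleGraph.mem_neighborSet, Prod.mk.injEq]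
    constructor
    · rintro ⟨h, rfl, _⟩
      exact ⟨v, h, rfl, rfl⟩
    · rintro ⟨w, h, rfl, rfl⟩
      exact ⟨h, rfl, h.ne'⟩
  rw [h]
  exact Set.ncard_image_of_injective _ (fun a b h => by simpa using h)

lemma prs_finite {V : Type*} (G : SimpleGraph V) (hf : ∀ v, (G.neighborSet v).Finite)
    (A : Set V) (hA : A.Finite) : (prs G A).Finite := by
  refine (hA.biUnion (fun u _ => (hf u).image (fun v => (u, v)))).subset ?_
  rintro ⟨u, v⟩ ⟨h, hu, hv⟩
  simp only [Set.mem_iUnion]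
  exact ⟨u, hu, v, h, rfl⟩

lemma prs_submod {V : Type*} (G : SimpleGraph V) (hf : ∀ v, (G.neighborSet v).Finite)
    (A B : Set V) (hA : A.Finite) (hB : B.Finite) :
    (prs G (A ∩ B)).ncard + (prs G (A ∪ B)).ncard ≤ (prs G A).ncard + (prs G B).ncard := by
  have fA := prs_finite G hf A hA
  have fB := prs_finite G hf B hB
  rw [← Set.ncard_union_add_ncard_inter _ _ (prs_finite G hf _ (hA.inter_of_left B))
    (prs_finite G hf _ (hA.union hB)), ← Set.ncard_union_add_ncard_inter _ _ fA fB]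
  apply add_le_add
  · apply Set.ncard_le_ncard _ (fA.union fB)
    rintro ⟨u, v⟩
    simp only [prs, Set.mem_union, Set.mem_inter_iff, Set.mem_ofPred_eq]
    tauto
  · apply Set.ncard_le_ncard _ (fA.inter_of_left _)
    rintro ⟨u, v⟩
    simp only [prs, Set.mem_union, Set.mem_inter_iff, Set.mem_ofPred_eq]
    tauto

lemma prs_image {V : Type*} (G : SimpleGraph V) (φ : G ≃g G) (A : Set V) :
    (prs G (φ '' A)).ncard = (prs G A).ncard := by
  have h : prs G (φ '' A) = (fun p : V × V => (φ p.1, φ p.2)) '' prs G A := by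
    ext ⟨u, v⟩
    obtain ⟨u, rfl⟩ := φ.surjective u
    obtain ⟨v, rfl⟩ := φ.surjective v
    have hi : ∀ w, φ w ∈ φ '' A ↔ w ∈ A := fun w => φ.injective.mem_set_image
    constructor
    · rintro ⟨h1, h2, h3⟩
      exact ⟨(u, v), ⟨φ.map_adj_iff.1 h1, (hi u).1 h2, fun h => h3 ((hi v).2 h)⟩, rfl⟩
    · rintro ⟨⟨a, b⟩, ⟨h1, h2, h3⟩, h⟩
      obtain ⟨h4, h5⟩ := Prod.mk.inj h
      obtain rfl := φ.injective h4
      obtain rfl := φ.injective h5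
      exact ⟨φ.map_adj_iff.2 h1, (hi _).2 h2, fun h => h3 ((hi _).1 h)⟩
  rw [h]
  apply Set.ncard_image_of_injective
  rintro ⟨a, b⟩ ⟨c, e⟩ h
  simpa using h

lemma lower {V : Type*} [Infinite V] (d : ℕ) (hd : 0 < d) (G : SimpleGraph V)
    (hconn : G.Connected)
    (hreg : ∀ v : V, (G.neighborSet v).ncard = d)
    (htrans : ∀ x y : V, ∃ φ : G ≃g G, φ x = y)
    (A : Set V) (hne : A.Nonempty) (hfin : A.Finite)
    (hmin : ∀ B : Set V, B.Nonempty → B.Finite → (prs G A).ncard ≤ (prs G B).ncard)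
    (hmin2 : ∀ B : Set V, B.Nonempty → B.Finite → (prs G B).ncard = (prs G A).ncard →
      A.ncard ≤ B.ncard) : d ≤ (prs G A).ncard := by
  have hf : ∀ v, (G.neighborSet v).Finite := fun v =>
    Set.finite_of_ncard_pos (by rw [hreg]; exact hd)
  -- translates
  have key : ∀ φ : G ≃g G, (A ∩ φ '' A).Nonempty → φ '' A = A := by
    intro φ hn
    have hB : (φ '' A).Finite := hfin.image _
    have h1 := prs_submod G hf A (φ '' A) hfin hB
    rw [prs_image] at h1
    have h2 := hmin _ hn (hfin.inter_of_left _)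
    have h3 := hmin (A ∪ φ '' A) (hne.inl) (hfin.union hB)
    have h4 := hmin2 _ hn (hfin.inter_of_left _) (by omega)
    have h5 : A ∩ φ '' A = A := Set.eq_of_subset_of_ncard_le Set.inter_subset_left h4 hfin
    have h6 : A ⊆ φ '' A := Set.inter_eq_left.mp h5
    refine (Set.eq_of_subset_of_ncard_le h6 ?_ hB).symm
    rw [Set.ncard_image_of_injective _ φ.injective]
  -- boundary vertex
  obtain ⟨x, hx, y, hy, hxy⟩ : ∃ x ∈ A, ∃ y, y ∉ A ∧ G.Adj x y := by
    obtain ⟨a, ha⟩ := hne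
    obtain ⟨b, hb⟩ := hfin.exists_notMem
    obtain ⟨w⟩ := hconn.preconnected a b
    obtain ⟨e, _, h1, h2⟩ := w.exists_boundary_dart A ha hb
    exact ⟨e.fst, h1, e.snd, h2, e.adj⟩
  set k := (G.neighborSet x \ A).ncard with hk
  have hk1 : 1 ≤ k := by
    rw [hk, Nat.one_le_iff_ne_zero, ← Nat.pos_iff_ne_zero,
      Set.ncard_pos ((hf x).subset Set.sdiff_subset)]
    exact ⟨y, hxy, hy⟩
  have hall : ∀ z ∈ A, (G.neighborSet z \ A).ncard = k := by
    intro z hz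
    obtain ⟨φ, hφ⟩ := htrans x z
    have hA : φ '' A = A := key φ ⟨z, hz, x, hx, hφ⟩
    have : G.neighborSet z \ A = φ '' (G.neighborSet x \ A) := by
      rw [Set.image_sdiff φ.injective, hA, ← hφ]
      congr 1
      ext w
      obtain ⟨w, rfl⟩ := φ.surjective w
      simp [φ.map_adj_iff]
    rw [this, Set.ncard_image_of_injective _ φ.injective]
  have hdeg : d ≤ k + (A.ncard - 1) := by
    rw [← hreg x, ← Set.ncard_inter_add_ncard_sdiff_eq_ncard (G.neighborSet x) A (hf x), ← hk, add_comm,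
      ← Set.ncard_diff_singleton_of_mem hx]
    gcongr
    · exact hfin.subset Set.sdiff_subset
    · rintro w ⟨h1, h2⟩
      exact ⟨h2, h1.ne'⟩
  have hpos : 0 < A.ncard := (Set.ncard_pos hfin).2 hne
  have hcount : (prs G A).ncard = A.ncard * k := by
    have fP := prs_finite G hf A hfin
    rw [Set.ncard_eq_toFinset_card _ fP, Set.ncard_eq_toFinset_card _ hfin]
    rw [Finset.card_eq_sum_card_fiberwise (f := Prod.fst) (t := hfin.toFinset)]
    · rw [Finset.sum_const_nat]
      intro z hz
      have hz : z ∈ A := by simpa using hz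
      rw [← hall z hz, ← Set.ncard_coe_finset,
        ← Set.ncard_image_of_injective (f := fun v : V => (z, v)) (G.neighborSet z \ A) (fun a b h => by simpa using h)]
      apply congrArg Set.ncard
      ext ⟨u, v⟩
      simp only [prs, Finset.coe_filter, Set.Finite.mem_toFinset, Set.mem_ofPred_eq, Set.mem_image,
        Set.mem_diff, SimpleGraph.mem_neighborSet, Prod.mk.injEq]
      constructor
      · rintro ⟨⟨h1, h2, h3⟩, rfl⟩
        exact ⟨v, ⟨h1, h3⟩, rfl, rfl⟩
      · rintro ⟨w, ⟨h1, h3⟩, rfl, rfl⟩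
        exact ⟨⟨h1, hz, h3⟩, rfl⟩
    · rintro ⟨u, v⟩ h
      simp only [prs, Set.Finite.coe_toFinset, Set.mem_ofPred_eq] at h ⊢
      exact h.2.1
  rw [hcount]
  obtain ⟨m, hm⟩ : ∃ m, A.ncard = m + 1 := ⟨A.ncard - 1, by omega⟩
  obtain ⟨j, hj⟩ : ∃ j, k = j + 1 := ⟨k - 1, by omega⟩
  have hdeg' : d ≤ (j + 1) + m := by omega
  rw [hm, hj]
  nlinarith [Nat.zero_le (m * j)]

/-- In an infinite, connected, `d`-regular, vertex-transitive simple graph, the minimum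
over all nonempty finite vertex sets `A` of the number of edges between `A` and its
complement equals `d`. -/
theorem best_cut_size_eq_degree {V : Type*} [Infinite V] (d : ℕ) (G : SimpleGraph V)
    (hconn : G.Connected)
    (hreg : ∀ v : V, (G.neighborSet v).ncard = d)
    (htrans : ∀ x y : V, ∃ φ : G ≃g G, φ x = y) :
    IsLeast {n : ℕ | ∃ A : Set V, A.Nonempty ∧ A.Finite ∧ (cutEdges G A).ncard = n} d := by
  constructor
  · obtain ⟨x⟩ := hconn.nonempty
    exact ⟨{x}, Set.singleton_nonempty x, Set.finite_singleton x, by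
      rw [cut_eq, prs_single, hreg]⟩
  · rintro n ⟨A, hne, hfin, rfl⟩
    rw [cut_eq]
    rcases Nat.eq_zero_or_pos d with rfl | hd
    · exact Nat.zero_le _
    have h1 : ∃ c, ∃ B : Set V, B.Nonempty ∧ B.Finite ∧ (prs G B).ncard = c :=
      ⟨_, A, hne, hfin, rfl⟩
    have h2 : ∃ s, ∃ B : Set V, B.Nonempty ∧ B.Finite ∧ (prs G B).ncard = Nat.find h1 ∧
        B.ncard = s := by
      obtain ⟨B, hB⟩ := Nat.find_spec h1
      exact ⟨_, B, hB.1, hB.2.1, hB.2.2, rfl⟩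
    obtain ⟨B, b1, b2, b3, b4⟩ := Nat.find_spec h2
    have hm : ∀ C : Set V, C.Nonempty → C.Finite → (prs G B).ncard ≤ (prs G C).ncard := by
      intro C c1 c2
      rw [b3]
      exact Nat.find_min' h1 ⟨C, c1, c2, rfl⟩
    refine (lower d hd G hconn hreg htrans B b1 b2 hm ?_).trans (hm A hne hfin)
    intro C c1 c2 c3
    rw [b4]
    exact Nat.find_min' h2 ⟨C, c1, c2, c3.trans b3, rfl⟩

end PaperPM
end

section
/- Let G be an infinite, connected, d-regular, vertex-transitive simple graph on vertex set V. Then for every finite set Y ⊆ V, the number of finite connected components of the induced subgraph G − Y (on vertex set V \ Y) is at most |Y|. -/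
open scoped Classical

namespace PaperPM

noncomputable def inn {V : Type*} (G : SimpleGraph V) (A : Finset V) : Finset (V × V) :=
  (A ×ˢ A).filter (fun p => G.Adj p.1 p.2)

lemma mem_inn {V : Type*} (G : SimpleGraph V) (A : Finset V) (p : V × V) :
    p ∈ inn G A ↔ (p.1 ∈ A ∧ p.2 ∈ A) ∧ G.Adj p.1 p.2 := by
  simp [inn]

lemma inn_super {V : Type*} (G : SimpleGraph V) (A B : Finset V) :
    (inn G A).card + (inn G B).card ≤ (inn G (A ∪ B)).card + (inn G (A ∩ B)).card := by
  rw [← Finset.card_union_add_card_inter]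
  have h1 : (inn G A ∪ inn G B) ⊆ inn G (A ∪ B) := by
    intro p
    simp only [Finset.mem_union, mem_inn]
    tauto
  have h2 : (inn G A ∩ inn G B) ⊆ inn G (A ∩ B) := by
    intro p
    simp only [Finset.mem_inter, mem_inn]
    tauto
  exact add_le_add (Finset.card_le_card h1) (Finset.card_le_card h2)

lemma card_filter_prod {V : Type*} (G : SimpleGraph V) (A B : Finset V) :
    ((A ×ˢ B).filter (fun p => G.Adj p.1 p.2)).card
      = ∑ x ∈ A, (B.filter (fun y => G.Adj x y)).card := by
  rw [Finset.card_filter, Finset.sum_product]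
  simp only [Finset.card_filter]

lemma inn_map {V : Type*} (G : SimpleGraph V) (φ : G ≃g G) (A : Finset V) :
    (inn G (A.image φ)).card = (inn G A).card := by
  symm
  apply Finset.card_bij (fun p _ => (φ p.1, φ p.2))
  · intro p hp
    rw [mem_inn] at hp ⊢
    exact ⟨⟨Finset.mem_image_of_mem _ hp.1.1, Finset.mem_image_of_mem _ hp.1.2⟩,
      φ.map_adj_iff.2 hp.2⟩
  · rintro ⟨a, b⟩ _ ⟨c, e⟩ _ h
    simpa using h
  · rintro ⟨a, b⟩ h
    rw [mem_inn] at h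
    obtain ⟨⟨h1, h2⟩, h3⟩ := h
    obtain ⟨x, hx, rfl⟩ := Finset.mem_image.1 h1
    obtain ⟨y, hy, rfl⟩ := Finset.mem_image.1 h2
    exact ⟨(x, y), by rw [mem_inn]; exact ⟨⟨hx, hy⟩, φ.map_adj_iff.1 h3⟩, rfl⟩

lemma boundary {V : Type*} [Infinite V] (G : SimpleGraph V) (hconn : G.Connected)
    (A : Finset V) (hA : A.Nonempty) : ∃ x ∈ A, ∃ y, y ∉ A ∧ G.Adj x y := by
  obtain ⟨a, ha⟩ := hA
  obtain ⟨b, hb⟩ := Infinite.exists_notMem_finset A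
  obtain ⟨w⟩ := hconn.preconnected a b
  obtain ⟨e, _, h1, h2⟩ := w.exists_boundary_dart (A : Set V) (by simpa using ha) (by simpa using hb)
  exact ⟨e.fst, by simpa using h1, e.snd, by simpa using h2, e.adj⟩

lemma edge_conn {V : Type*} [Infinite V] (d : ℕ) (G : SimpleGraph V) (hconn : G.Connected)
    (N : V → Finset V) (hN : ∀ x y, y ∈ N x ↔ G.Adj x y) (hd : ∀ x, (N x).card = d)
    (htrans : ∀ x y : V, ∃ φ : G ≃g G, φ x = y) (A₀ : Finset V) (hA₀ : A₀.Nonempty) :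
    (inn G A₀).card + d ≤ d * A₀.card := by
  have hle : ∀ A : Finset V, (inn G A).card ≤ d * A.card := by
    intro A
    unfold inn
    rw [card_filter_prod, mul_comm, ← smul_eq_mul]
    apply Finset.sum_le_card_nsmul
    intro x _
    rw [← hd x]
    apply Finset.card_le_card
    intro y hy
    exact (hN x y).2 (Finset.mem_filter.1 hy).2
  let b : Finset V → ℕ := fun A => d * A.card - (inn G A).card
  have hb : ∀ A, b A + (inn G A).card = d * A.card := fun A => Nat.sub_add_cancel (hle A)
  obtain ⟨A1, hA1, hmin1⟩ := WellFounded.has_min (measure b).wf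
    {A : Finset V | A.Nonempty} ⟨A₀, hA₀⟩
  obtain ⟨A, ⟨hA, hAb⟩, hmin2⟩ := WellFounded.has_min (measure (Finset.card (α := V))).wf
    {A : Finset V | A.Nonempty ∧ b A = b A1} ⟨A1, hA1, rfl⟩
  have m1 : ∀ B : Finset V, B.Nonempty → b A ≤ b B := by
    intro B hB
    rw [hAb]
    exact not_lt.1 (hmin1 B hB)
  have m2 : ∀ B : Finset V, B.Nonempty → b B = b A → A.card ≤ B.card := by
    intro B hB h
    exact not_lt.1 (hmin2 B ⟨hB, h.trans hAb⟩)
  have block : ∀ φ : G ≃g G, (A ∩ A.image φ).Nonempty → A.image φ = A := by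
    intro φ hne
    have hc : (A.image φ).card = A.card := Finset.card_image_of_injective _ φ.injective
    have h1 := inn_super G A (A.image φ)
    have h2 := inn_map G φ A
    have h3 := Finset.card_union_add_card_inter A (A.image φ)
    have h4 := m1 _ hne
    have h5 := m1 (A ∪ A.image φ) (hA.mono Finset.subset_union_left)
    have e1 := hb A
    have e3 := hb (A ∪ A.image φ)
    have e4 := hb (A ∩ A.image φ)
    have h6 : d * (A ∪ A.image φ).card + d * (A ∩ A.image φ).card = d * A.card + d * A.card := by
      rw [← mul_add, h3, hc, mul_add]
    have h7 := m2 _ hne (by omega)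
    have h8 : A ∩ A.image φ = A := Finset.eq_of_subset_of_card_le Finset.inter_subset_left h7
    have h9 : A ⊆ A.image φ := Finset.inter_eq_left.1 h8
    exact (Finset.eq_of_subset_of_card_le h9 hc.le).symm
  obtain ⟨x, hx, z, hz, hxz⟩ := boundary G hconn A hA
  set r := (A.filter (fun y => G.Adj x y)).card with hr
  have hr1 : r + 1 ≤ A.card := by
    apply Finset.card_lt_card
    refine Finset.ssubset_iff_subset_ne.2 ⟨Finset.filter_subset _ _, fun h => ?_⟩
    rw [← h] at hx
    exact G.loopless.irrefl x (Finset.mem_filter.1 hx).2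
  have hr2 : r + 1 ≤ d := by
    rw [← hd x]
    apply Finset.card_lt_card
    refine Finset.ssubset_iff_subset_ne.2
      ⟨fun y hy => (hN x y).2 (Finset.mem_filter.1 hy).2, fun h => ?_⟩
    have := (hN x z).2 hxz
    rw [← h] at this
    exact hz (Finset.mem_filter.1 this).1
  have hconst : ∀ y ∈ A, (A.filter (fun w => G.Adj y w)).card = r := by
    intro y hy
    obtain ⟨φ, hφ⟩ := htrans x y
    have hbl := block φ ⟨y, Finset.mem_inter.2 ⟨hy, Finset.mem_image.2 ⟨x, hx, hφ⟩⟩⟩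
    rw [hr, ← Finset.card_image_of_injective (A.filter (fun y => G.Adj x y)) φ.injective]
    congr 1
    ext w
    simp only [Finset.mem_filter, Finset.mem_image]
    constructor
    · rintro ⟨hw, hyw⟩
      rw [← hbl] at hw
      obtain ⟨u, hu, rfl⟩ := Finset.mem_image.1 hw
      rw [← hφ] at hyw
      exact ⟨u, ⟨hu, φ.map_adj_iff.1 hyw⟩, rfl⟩
    · rintro ⟨u, ⟨hu, hxu⟩, rfl⟩
      refine ⟨?_, ?_⟩
      · rw [← hbl]; exact Finset.mem_image_of_mem _ hu
      · rw [← hφ]; exact φ.map_adj_iff.2 hxu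
  have hi : (inn G A).card = A.card * r := by
    unfold inn
    rw [card_filter_prod, Finset.sum_congr rfl hconst]
    simp
  have hbA : d ≤ b A := by
    have e := hb A
    rw [hi] at e
    obtain ⟨k, hk⟩ := Nat.exists_eq_add_of_le hr2
    obtain ⟨l, hl⟩ := Nat.exists_eq_add_of_le hr1
    rw [hl] at e
    rw [hk] at e ⊢
    nlinarith [Nat.zero_le (r * k), Nat.zero_le (l * k)]
  have := m1 A₀ hA₀
  have := hb A₀
  omega

theorem finite_components_le_card_removed {V : Type*} [Infinite V]
    (d : ℕ) (G : SimpleGraph V)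
    (hconn : G.Connected)
    (hreg : ∀ v : V, (G.neighborSet v).ncard = d)
    (htrans : ∀ x y : V, ∃ φ : G ≃g G, φ x = y)
    (Y : Set V) (hY : Y.Finite) :
    {c : (G.induce (Yᶜ : Set V)).ConnectedComponent | c.supp.Finite}.encard ≤ Y.encard := by
  set S := {c : (G.induce (Yᶜ : Set V)).ConnectedComponent | c.supp.Finite} with hS
  -- neighbours of a component
  have hnb : ∀ c : (G.induce (Yᶜ : Set V)).ConnectedComponent, ∀ a ∈ Subtype.val '' c.supp,
      ∀ y, G.Adj a y → y ∈ Subtype.val '' c.supp ∨ y ∈ Y := by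
    rintro c _ ⟨a, ha, rfl⟩ y hy
    by_cases h : y ∈ Y
    · exact Or.inr h
    · refine Or.inl ⟨⟨y, h⟩, ?_, rfl⟩
      have hadj : (G.induce (Yᶜ : Set V)).Adj a ⟨y, h⟩ := hy
      rw [SimpleGraph.ConnectedComponent.mem_supp_iff] at ha ⊢
      rw [← ha]
      exact SimpleGraph.ConnectedComponent.sound hadj.symm.reachable
  by_cases hfin : ∀ v, (G.neighborSet v).Finite
  swap
  · have hinf : ∀ v, ¬ (G.neighborSet v).Finite := by
      push Not at hfin
      obtain ⟨v, hv⟩ := hfin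
      intro w hw
      obtain ⟨φ, rfl⟩ := htrans w v
      apply hv
      refine (hw.image φ).subset ?_
      intro u hu
      refine ⟨φ.symm u, ?_, by simp⟩
      have : G.Adj (φ w) (φ (φ.symm u)) := by simpa using hu
      exact φ.map_adj_iff.1 this
    have : S = ∅ := by
      rw [Set.eq_empty_iff_forall_notMem]
      intro c hc
      obtain ⟨a, ha⟩ := c.nonempty_supp
      apply hinf a.1
      refine ((Set.Finite.image Subtype.val hc).union hY).subset ?_
      intro y hy
      exact hnb c a ⟨a, ha, rfl⟩ y hy
    rw [this]
    simp
  let N : V → Finset V := fun v => (hfin v).toFinset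
  have hN : ∀ x y, y ∈ N x ↔ G.Adj x y := by simp [N]
  have hd : ∀ x, (N x).card = d := by
    intro x
    rw [← hreg x, Set.ncard_eq_toFinset_card _ (hfin x)]
  have hdpos : 0 < d := by
    obtain ⟨v⟩ := hconn.nonempty
    obtain ⟨x, _, y, _, hxy⟩ := boundary G hconn {v} (by simp)
    rw [← hd x]
    exact Finset.card_pos.2 ⟨y, (hN x y).2 hxy⟩
  by_contra hlt
  rw [not_le] at hlt
  obtain ⟨Z, rfl⟩ := hY.exists_finset_coe
  rw [Set.encard_coe_eq_coe_finsetCard] at hlt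
  obtain ⟨T', hT'S, hT'⟩ := Set.exists_subset_encard_eq (Order.add_one_le_of_lt hlt)
  have hT'f : T'.Finite := Set.finite_of_encard_eq_coe (k := Z.card + 1) (by simpa using hT')
  obtain ⟨T, rfl⟩ := hT'f.exists_finset_coe
  rw [Set.encard_coe_eq_coe_finsetCard] at hT'
  have hT : T.card = Z.card + 1 := by exact_mod_cast hT'
  let K : (G.induce ((Z : Set V)ᶜ : Set V)).ConnectedComponent → Finset V := fun c =>
    if h : (Subtype.val '' c.supp).Finite then h.toFinset else ∅
  have hK : ∀ c ∈ T, ∀ v, v ∈ K c ↔ v ∈ Subtype.val '' c.supp := by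
    intro c hc v
    have : (Subtype.val '' c.supp).Finite := Set.Finite.image _ (hT'S hc)
    simp only [K, dif_pos this, Set.Finite.mem_toFinset]
  have hKZ : ∀ c ∈ T, Disjoint (K c) Z := by
    intro c hc
    rw [Finset.disjoint_left]
    intro v hv hvZ
    obtain ⟨a, _, rfl⟩ := (hK c hc v).1 hv
    exact a.2 hvZ
  let P : (G.induce ((Z : Set V)ᶜ : Set V)).ConnectedComponent → Finset (V × V) := fun c =>
    (K c ×ˢ Z).filter (fun p => G.Adj p.1 p.2)
  have hP : ∀ c ∈ T, d ≤ (P c).card := by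
    intro c hc
    have hne : (K c).Nonempty := by
      obtain ⟨a, ha⟩ := c.nonempty_supp
      exact ⟨a, (hK c hc _).2 ⟨a, ha, rfl⟩⟩
    have h1 := edge_conn d G hconn N hN hd htrans (K c) hne
    have h2 : (inn G (K c)).card + (P c).card = d * (K c).card := by
      simp only [inn, P]
      rw [card_filter_prod, card_filter_prod, ← Finset.sum_add_distrib]
      rw [mul_comm, ← smul_eq_mul, ← Finset.sum_const]
      apply Finset.sum_congr rfl
      intro x hx
      rw [← hd x, ← Finset.card_union_of_disjoint
        (Finset.disjoint_filter_filter (hKZ c hc)), ← Finset.filter_union]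
      congr 1
      ext y
      rw [hN, Finset.mem_filter, Finset.mem_union]
      constructor
      · exact fun h => h.2
      · intro h
        refine ⟨?_, h⟩
        rcases hnb c x ((hK c hc x).1 hx) y h with h' | h'
        · exact Or.inl ((hK c hc y).2 h')
        · exact Or.inr (by simpa using h')
    omega
  have hdisj : ∀ c ∈ T, ∀ c' ∈ T, c ≠ c' → Disjoint (P c) (P c') := by
    intro c hc c' hc' hne
    rw [Finset.disjoint_left]
    intro p hp hp'
    have q := (Finset.mem_product.1 (Finset.mem_filter.1 hp).1).1
    have q' := (Finset.mem_product.1 (Finset.mem_filter.1 hp').1).1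
    obtain ⟨a, ha, hap⟩ := (hK c hc _).1 q
    obtain ⟨a', ha', hap'⟩ := (hK c' hc' _).1 q'
    have : a = a' := Subtype.ext (hap.trans hap'.symm)
    subst this
    rw [SimpleGraph.ConnectedComponent.mem_supp_iff] at ha ha'
    exact hne (ha.symm.trans ha')
  have hlow : T.card * d ≤ (T.biUnion P).card := by
    rw [Finset.card_biUnion hdisj, ← smul_eq_mul]
    exact Finset.card_nsmul_le_sum _ _ _ hP
  have hup : (T.biUnion P).card ≤ Z.card * d := by
    have : (Z.sigma N).card = Z.card * d := by
      rw [Finset.card_sigma, Finset.sum_congr rfl (fun x _ => hd x)]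
      simp
    rw [← this]
    apply Finset.card_le_card_of_injOn (fun p => ⟨p.2, p.1⟩)
    · intro p hp
      obtain ⟨c, hc, hp⟩ := Finset.mem_biUnion.1 (Finset.mem_coe.1 hp)
      obtain ⟨h1, h2⟩ := Finset.mem_filter.1 hp
      exact Finset.mem_coe.2 (Finset.mem_sigma.2 ⟨(Finset.mem_product.1 h1).2, (hN _ _).2 h2.symm⟩)
    · rintro ⟨a, b⟩ _ ⟨a', b'⟩ _ h
      simp at h
      simp [h.1, h.2]
  have := Nat.le_of_mul_le_mul_right (hlow.trans hup) hdpos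
  omega

end PaperPM
end

section
/- Let G be a simple graph with a matching M. Let p be an alternating path of even length from x to y and q an alternating path of odd length from y to z. Then there exists an alternating path of odd length at most |p| + |q| from x to y or from x to z. -/
open scoped Classical

namespace PaperPM

variable {V : Type*}

/-- A vertex is matched by the edge set `M` if some edge of `M` contains it. -/
def Matched (M : Set (Sym2 V)) (v : V) : Prop := ∃ e ∈ M, v ∈ e

/-- `M` is a matching in `G`: a set of edges of `G`, no two sharing a vertex. -/
def IsMatching (G : SimpleGraph V) (M : Set (Sym2 V)) : Prop :=
  M ⊆ G.edgeSet ∧ ∀ e ∈ M, ∀ f ∈ M, ∀ v : V, v ∈ e → v ∈ f → e = f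

/-- `p` is an alternating path w.r.t. the matching `M`: a path in `G` (consecutive
vertices adjacent, no repeated vertices) whose first edge is not in `M` and whose
edges lie alternately outside and inside `M`. -/
def IsAltPath (G : SimpleGraph V) (M : Set (Sym2 V)) (p : List V) : Prop :=
  p ≠ [] ∧ p.Chain' G.Adj ∧ p.Nodup ∧
    ∀ (i : ℕ) (h : i + 1 < p.length),
      (s(p[i]'(Nat.lt_of_succ_lt h), p[i + 1]'h) ∈ M ↔ i % 2 = 1)

/-- The length (number of edges) of a path given as a list of vertices. -/
def pathLen (p : List V) : ℕ := p.length - 1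

/-- An alternating path from `x` to `y`. -/
def IsAltPathFrom (G : SimpleGraph V) (M : Set (Sym2 V)) (x y : V) (p : List V) : Prop :=
  IsAltPath G M p ∧ p.head? = some x ∧ p.getLast? = some y

theorem glue_aux (G : SimpleGraph V) (M : Set (Sym2 V)) (x w : V) (p s : List V) (i : ℕ)
    (hp : IsAltPath G M p) (hx : p.head? = some x) (hi : i < p.length) (h0 : 0 < s.length)
    (hs0 : s[0] = p[i]) (hch : ∀ k (h : k + 1 < s.length), G.Adj s[k] s[k+1])
    (hnd : s.Nodup) (hdis : ∀ k (h : k < i), p[k] ∉ s)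
    (hw : s.getLast? = some w)
    (halt : ∀ k (h : k + 1 < s.length), (s(s[k], s[k+1]) ∈ M ↔ (i + k) % 2 = 1)) :
    IsAltPath G M (p.take i ++ s) ∧ (p.take i ++ s).head? = some x ∧
      (p.take i ++ s).getLast? = some w ∧ pathLen (p.take i ++ s) = i + (s.length - 1) := by
  obtain ⟨hne, hc, hn, ha⟩ := hp
  have hc' : ∀ k (h : k + 1 < p.length), G.Adj p[k] p[k+1] := by
    intro k h
    exact List.isChain_iff_getElem.mp hc k h
  have hl : (p.take i).length = i := by simp; omega
  have key : ∀ k (h : k + 1 < (p.take i ++ s).length),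
      (∃ h1 : k + 1 < p.length, k < i ∧ (p.take i ++ s)[k] = p[k] ∧ (p.take i ++ s)[k+1] = p[k+1]) ∨
      (∃ j, ∃ h1 : j + 1 < s.length, k = i + j ∧ (p.take i ++ s)[k] = s[j] ∧
        (p.take i ++ s)[k+1] = s[j+1]) := by
    intro k h
    rw [List.length_append, hl] at h
    by_cases hk : k < i
    · left
      refine ⟨by omega, hk, by grind, ?_⟩
      by_cases hk' : k + 1 < i
      · grind
      · have : k + 1 = i := by omega
        subst this
        rw [List.getElem_append_right (by omega)]
        simp only [hl, Nat.sub_self, hs0]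
    · right
      refine ⟨k - i, by omega, by omega, ?_, ?_⟩
      · rw [List.getElem_append_right (by omega)]
        simp only [hl]
      · rw [List.getElem_append_right (by omega)]
        simp only [hl]
        congr 1
        omega
  refine ⟨⟨?_, ?_, ?_, ?_⟩, ?_, ?_, ?_⟩
  · grind
  · refine List.isChain_iff_getElem.mpr ?_
    intro k h
    rcases key k h with ⟨h1, _, e1, e2⟩ | ⟨j, h1, _, e1, e2⟩
    · rw [e1, e2]; exact hc' k h1
    · rw [e1, e2]; exact hch j h1
  · rw [List.nodup_append']
    refine ⟨hn.sublist (List.take_sublist _ _), hnd, ?_⟩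
    intro a ha1 ha2
    obtain ⟨k, hk, rfl⟩ := List.mem_iff_getElem.mp ha1
    rw [List.getElem_take] at ha2
    exact hdis k (by omega) ha2
  · intro k h
    rcases key k h with ⟨h1, _, e1, e2⟩ | ⟨j, h1, e, e1, e2⟩
    · rw [e1, e2]; exact ha k h1
    · rw [e1, e2, e]; exact halt j h1
  · rcases i with _ | i
    · rw [List.take_zero, List.nil_append]
      rw [List.head?_eq_getElem?, List.getElem?_eq_getElem hi] at hx
      rw [List.head?_eq_getElem?, List.getElem?_eq_getElem h0, hs0]
      exact hx
    · clear key halt hdis hch hc' ha hc hs0 hn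
      cases p with
      | nil => exact absurd rfl hne
      | cons a t => simpa using hx
  · rw [List.getLast?_append, hw]; rfl
  · simp only [pathLen, List.length_append, hl]; omega

/-- If `p` is an even alternating path from `x` to `y` and `q` is an odd alternating
path from `y` to `z`, then there is an odd alternating path of length at most
`|p| + |q|` from `x` to `y` or from `x` to `z`. -/
theorem concat_alternating_paths (G : SimpleGraph V) (M : Set (Sym2 V))
    (hM : IsMatching G M) (x y z : V) (p q : List V)
    (hp : IsAltPathFrom G M x y p) (hpeven : Even (pathLen p))
    (hq : IsAltPathFrom G M y z q) (hqodd : Odd (pathLen q)) :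
    ∃ r : List V, IsAltPath G M r ∧ Odd (pathLen r) ∧
      pathLen r ≤ pathLen p + pathLen q ∧
      r.head? = some x ∧ (r.getLast? = some y ∨ r.getLast? = some z) := by
  classical
  obtain ⟨hpa, hpx, hpy⟩ := hp
  obtain ⟨⟨qne, qc, qn, qa⟩, hqy, hqz⟩ := hq
  have qc' : ∀ k (h : k + 1 < q.length), G.Adj q[k] q[k+1] := by
    intro k h
    exact List.isChain_iff_getElem.mp qc k h
  have hpl : 0 < p.length := List.length_pos_iff.mpr hpa.1
  have hql : 0 < q.length := List.length_pos_iff.mpr qne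
  have hex : ∃ i, ∃ h : i < p.length, p[i] ∈ q := by
    refine ⟨p.length - 1, by omega, ?_⟩
    have h1 : p[p.length - 1] = y := by grind
    rw [h1]
    exact List.mem_of_mem_head? hqy
  obtain ⟨hi, hiq⟩ := Nat.find_spec hex
  have hmin : ∀ k (h : k < Nat.find hex) (h' : k < p.length), p[k] ∉ q := by
    intro k h h' hk
    exact Nat.find_min hex h ⟨h', hk⟩
  generalize Nat.find hex = i at hi hiq hmin
  obtain ⟨j, hj, hje⟩ := List.mem_iff_getElem.mp hiq
  unfold pathLen at hpeven hqodd
  by_cases hpar : i % 2 = j % 2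
  · obtain ⟨h1, h2, h3, h4⟩ := glue_aux G M x z p (q.drop j) i hpa hpx hi (by simp; omega)
      (by simp [hje])
      (by intro k h; simp only [List.getElem_drop]; exact qc' (j + k) (by simp at h; omega))
      (qn.sublist (List.drop_sublist _ _))
      (fun k h hk => hmin k h (by omega) (List.mem_of_mem_drop hk))
      (by rw [List.getLast?_drop]; grind)
      (by
        intro k h
        simp only [List.getElem_drop]
        have := qa (j + k) (by simp at h; omega)
        simp only [← Nat.add_assoc]
        rw [this]
        omega)
    refine ⟨_, h1, ?_, ?_, h2, Or.inr h3⟩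
    · rw [h4]; simp only [List.length_drop]; grind
    · rw [h4]; simp only [List.length_drop, pathLen]; omega
  · have hlen : (q.take (j+1)).reverse.length = j + 1 := by simp; omega
    have hget : ∀ k (h : k < (q.take (j+1)).reverse.length),
        (q.take (j+1)).reverse[k] = q[j - k] := by
      intro k h
      rw [List.getElem_reverse, List.getElem_take]
      congr 1
      simp; omega
    obtain ⟨h1, h2, h3, h4⟩ := glue_aux G M x y p (q.take (j+1)).reverse i hpa hpx hi (by omega)
      (by rw [hget]; simpa using hje)
      (by
        intro k h
        rw [hget, hget]
        have := (qc' (j - (k+1)) (by omega)).symm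
        have e : j - (k + 1) + 1 = j - k := by omega
        simpa only [e] using this)
      (List.nodup_reverse.mpr (qn.sublist (List.take_sublist _ _)))
      (fun k h hk => hmin k h (by omega) (List.mem_of_mem_take (List.mem_reverse.mp hk)))
      (by rw [List.getLast?_reverse]; cases q <;> simp_all)
      (by
        intro k h
        rw [hget, hget]
        have := qa (j - (k+1)) (by omega)
        have e : j - (k + 1) + 1 = j - k := by omega
        simp only [e] at this
        rw [Sym2.eq_swap, this]
        omega)
    refine ⟨_, h1, ?_, ?_, h2, Or.inl h3⟩
    · rw [h4, hlen, Nat.odd_iff]; omega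
    · rw [h4, hlen]; simp only [pathLen]; omega

end PaperPM
end

section
/- Let G be a simple graph with a matching M, and suppose p and q are alternating paths both starting at the same vertex x (each with a first edge not in M) and both ending in the same matched edge vw but from different directions (p ends with the step v, w and q ends with the step w, v). Then there is a set U of vertices of q containing both v and w such that for every z ∈ U there exist two alternating paths from x to z of different length-parities, each starting with an edge not in M, lying entirely inside U together with the vertices of p, and whose lengths sum to at most |q| + 2|p| − 3. -/
open scoped Classical

namespace PaperPM

variable {V : Type*}

/-- Function version of alternating paths. -/
def AP (G : SimpleGraph V) (M : Set (Sym2 V)) (f : ℕ → V) (n : ℕ) : Prop :=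
  (∀ i, i < n → G.Adj (f i) (f (i + 1))) ∧
  (∀ i, i ≤ n → ∀ j, j ≤ n → f i = f j → i = j) ∧
  (∀ i, i < n → (s(f i, f (i + 1)) ∈ M ↔ i % 2 = 1))

theorem mate_unique {G : SimpleGraph V} {M : Set (Sym2 V)} (hM : IsMatching G M) {a b c : V}
    (h1 : s(a, b) ∈ M) (h2 : s(a, c) ∈ M) : b = c := by
  have h := hM.2 _ h1 _ h2 a (Sym2.mem_mk_left _ _) (Sym2.mem_mk_left _ _)
  exact Sym2.congr_right.mp h

theorem AP.trunc {G : SimpleGraph V} {M : Set (Sym2 V)} {f : ℕ → V} {n m : ℕ}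
    (h : AP G M f n) (hm : m ≤ n) : AP G M f m :=
  ⟨fun i hi => h.1 i (by omega), fun i hi j hj e => h.2.1 i (by omega) j (by omega) e,
    fun i hi => h.2.2 i (by omega)⟩

theorem AP.glue {G : SimpleGraph V} {M : Set (Sym2 V)} {r g : ℕ → V} {n m : ℕ}
    (h : AP G M r n) (h0 : g 0 = r n)
    (hadj : ∀ i, i < m → G.Adj (g i) (g (i + 1)))
    (hinj : ∀ i, i ≤ m → ∀ j, j ≤ m → g i = g j → i = j)
    (hdis : ∀ i, 1 ≤ i → i ≤ m → ∀ j, j ≤ n → g i ≠ r j)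
    (halt : ∀ i, i < m → (s(g i, g (i + 1)) ∈ M ↔ (i + n) % 2 = 1)) :
    AP G M (fun k => if k ≤ n then r k else g (k - n)) (n + m) := by
  have key : ∀ i, n ≤ i → (if i ≤ n then r i else g (i - n)) = g (i - n) := by
    intro i hi
    split_ifs with h1
    · obtain rfl : i = n := by omega
      simp [h0]
    · rfl
  refine ⟨?_, ?_, ?_⟩
  · intro i hi
    by_cases hin : i < n
    · simpa [hin.le, Nat.succ_le_of_lt hin] using h.1 i hin
    · simp only [key i (by omega), key (i + 1) (by omega)]
      have := hadj (i - n) (by omega)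
      rwa [show i - n + 1 = i + 1 - n by omega] at this
  · intro i hi j hj e
    simp only at e
    split_ifs at e with h1 h2 h2
    · exact h.2.1 i h1 j h2 e
    · exact absurd e.symm (hdis (j - n) (by omega) (by omega) i h1)
    · exact absurd e (hdis (i - n) (by omega) (by omega) j h2)
    · have := hinj (i - n) (by omega) (j - n) (by omega) e
      omega
  · intro i hi
    by_cases hin : i < n
    · simpa [hin.le, Nat.succ_le_of_lt hin] using h.2.2 i hin
    · simp only [key i (by omega), key (i + 1) (by omega)]
      have := halt (i - n) (by omega)
      rwa [show i - n + 1 = i + 1 - n by omega, show i - n + n = i by omega] at this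

/-- `z` is reached by two paths of different parities inside `S` with total length `≤ B`. -/
def Good (G : SimpleGraph V) (M : Set (Sym2 V)) (x z : V) (S : Set V) (B : ℕ) : Prop :=
  ∃ (r₁ : ℕ → V) (n₁ : ℕ) (r₂ : ℕ → V) (n₂ : ℕ), AP G M r₁ n₁ ∧ AP G M r₂ n₂ ∧
    r₁ 0 = x ∧ r₂ 0 = x ∧ r₁ n₁ = z ∧ r₂ n₂ = z ∧ n₁ % 2 ≠ n₂ % 2 ∧
    (∀ i, i ≤ n₁ → r₁ i ∈ S) ∧ (∀ i, i ≤ n₂ → r₂ i ∈ S) ∧ n₁ + n₂ ≤ B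

theorem Good.mono {G : SimpleGraph V} {M : Set (Sym2 V)} {x z : V} {S T : Set V} {B C : ℕ}
    (h : Good G M x z S B) (hS : S ⊆ T) (hB : B ≤ C) : Good G M x z T C := by
  obtain ⟨r₁, n₁, r₂, n₂, a1, a2, a3, a4, a5, a6, a7, a8, a9, a10⟩ := h
  exact ⟨r₁, n₁, r₂, n₂, a1, a2, a3, a4, a5, a6, a7, fun i hi => hS (a8 i hi),
    fun i hi => hS (a9 i hi), a10.trans hB⟩

def verts (p : ℕ → V) (a : ℕ) : Set V := {u | ∃ l, l ≤ a ∧ p l = u}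

theorem main_fun (G : SimpleGraph V) (M : Set (Sym2 V)) (hM : IsMatching G M) (b : ℕ) :
    ∀ (a : ℕ) (p q : ℕ → V), AP G M p a → AP G M q b → p 0 = q 0 → 2 ≤ a → 2 ≤ b →
      a % 2 = 0 → b % 2 = 0 → p (a - 1) = q b → p a = q (b - 1) →
      ∃ U : Set V, U ⊆ verts q b ∧ q b ∈ U ∧ q (b - 1) ∈ U ∧
        (∃ (r : ℕ → V) (n : ℕ), AP G M r n ∧ r 0 = p 0 ∧ r n = q b ∧ n % 2 = 0 ∧
          n ≤ a + b - 2 ∧ ∀ i, i ≤ n → r i ∈ U ∪ verts p a) ∧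
        ∀ z ∈ U, Good G M (p 0) z (U ∪ verts p a) (b + 2 * a - 3) := by
  induction b using Nat.strong_induction_on with
  | _ b ih =>
  intro a p q hp hq h0 ha hb ha2 hb2 e1 e2
  obtain ⟨i, hib, ⟨j, hja, hji⟩, hmax⟩ : ∃ i, i ≤ b - 2 ∧ q i ∈ verts p a ∧
      ∀ k, i < k → k ≤ b - 2 → q k ∉ verts p a := by
    have hex : ∃ k, k ≤ b - 2 ∧ q k ∈ verts p a := ⟨0, by omega, 0, by omega, h0⟩
    let P : ℕ → Prop := fun k => q k ∈ verts p a
    have hspec : P (Nat.findGreatest P (b - 2)) :=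
      Nat.findGreatest_spec (m := 0) (by omega) ⟨0, by omega, h0⟩
    exact ⟨Nat.findGreatest P (b - 2), Nat.findGreatest_le _, hspec,
      fun k hk hk2 => Nat.findGreatest_is_greatest hk hk2⟩
  have hja2 : j ≤ a - 2 := by
    by_contra hc
    rcases (by omega : j = a - 1 ∨ j = a) with rfl | rfl
    · have := hq.2.1 i (by omega) b le_rfl (by rw [← hji, e1]); omega
    · have := hq.2.1 i (by omega) (b - 1) (by omega) (by rw [← hji, e2]); omega
  -- the mate of `p j` on `p`
  have hmate : ∀ c, s(p j, c) ∈ M → j ≠ 0 → c ∈ verts p a := by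
    intro c hc hj
    by_cases hjo : j % 2 = 1
    · have := (hp.2.2 j (by omega)).2 hjo
      exact ⟨j + 1, by omega, mate_unique hM this hc⟩
    · have := (hp.2.2 (j - 1) (by omega)).2 (by omega)
      rw [show j - 1 + 1 = j by omega, Sym2.eq_swap] at this
      exact ⟨j - 1, by omega, mate_unique hM this hc⟩
  have hie : i % 2 = 0 := by
    by_contra hc
    have hm := (hq.2.2 i (by omega)).2 (by omega)
    rw [← hji] at hm
    have hj0 : j ≠ 0 := by
      rintro rfl
      have := hq.2.1 i (by omega) 0 (by omega) (by rw [← hji, h0]); omega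
    exact hmax (i + 1) (by omega) (by omega) (hmate _ hm hj0)
  obtain ⟨U', r, n, hU', hr, hr0, hrn, hn2, hn, hrin, hgood⟩ : ∃ (U' : Set V) (r : ℕ → V) (n : ℕ),
      U' ⊆ verts q i ∧ AP G M r n ∧ r 0 = p 0 ∧ r n = q i ∧ n % 2 = 0 ∧ n ≤ i + (a - 2) ∧
      (∀ k, k ≤ n → r k ∈ U' ∪ verts p (a - 2)) ∧
      ∀ z ∈ U', Good G M (p 0) z (U' ∪ verts p a) (b + 2 * a - 3) := by
    by_cases hj2 : j % 2 = 0
    · exact ⟨∅, p, j, by simp, hp.trunc hja, rfl, hji, hj2, by omega,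
        fun k hk => Or.inr ⟨k, by omega, rfl⟩, by simp⟩
    · have hi0 : i ≠ 0 := by
        rintro rfl
        have := hp.2.1 j hja 0 (by omega) (by rw [hji, h0]); omega
      have hm1 := (hp.2.2 j (by omega)).2 (by omega)
      have hm2 := (hq.2.2 (i - 1) (by omega)).2 (by omega)
      rw [show i - 1 + 1 = i by omega, Sym2.eq_swap, ← hji] at hm2
      have hmm := mate_unique hM hm1 hm2
      obtain ⟨U', hU1, hU2, hU3, ⟨r, n, hr, hr0, hrn, hn2, hn, hrin⟩, hg⟩ :=
        ih i (by omega) (j + 1) p q (hp.trunc (by omega)) (hq.trunc (by omega)) h0 (by omega)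
          (by omega) (by omega) hie (by simpa using hji) hmm
      refine ⟨U', r, n, hU1, hr, hr0, hrn, hn2, by omega, ?_, ?_⟩
      · intro k hk
        rcases hrin k hk with h | ⟨l, hl, h⟩
        · exact Or.inl h
        · exact Or.inr ⟨l, by omega, h⟩
      · intro z hz
        refine (hg z hz).mono ?_ (by omega)
        rintro u (h | ⟨l, hl, h⟩)
        · exact Or.inl h
        · exact Or.inr ⟨l, by omega, h⟩
  set U : Set V := U' ∪ {u | ∃ k, i < k ∧ k ≤ b ∧ q k = u} with hU
  have hqr : ∀ k, i < k → k ≤ b → ∀ l, l ≤ n → q k ≠ r l := by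
    intro k hk hkb l hl e
    rcases hrin l hl with h | ⟨t, ht, h⟩
    · obtain ⟨t, ht, h⟩ := hU' h
      have := hq.2.1 t (by omega) k hkb (by rw [h, e]); omega
    · rcases (by omega : k ≤ b - 2 ∨ k = b - 1 ∨ k = b) with hk2 | rfl | rfl
      · exact hmax k hk hk2 ⟨t, by omega, by rw [h, e]⟩
      · have := hp.2.1 t (by omega) a le_rfl (by rw [h, ← e, e2]); omega
      · have := hp.2.1 t (by omega) (a - 1) (by omega) (by rw [h, ← e, e1]); omega
  -- forward paths
  have hfwd : ∀ k, i < k → k ≤ b → ∃ r' : ℕ → V, AP G M r' (n + (k - i)) ∧ r' 0 = p 0 ∧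
      r' (n + (k - i)) = q k ∧ ∀ l, l ≤ n + (k - i) → r' l ∈ U ∪ verts p a := by
    intro k hk hkb
    refine ⟨_, AP.glue (g := fun t => q (i + t)) (m := k - i) hr (by simp [hrn]) ?_ ?_ ?_ ?_,
      by simp [hr0], ?_, ?_⟩
    · intro t ht; exact hq.1 (i + t) (by omega)
    · intro t ht t' ht' e
      have := hq.2.1 (i + t) (by omega) (i + t') (by omega) e
      omega
    · intro t ht1 ht2 l hl
      exact hqr _ (by omega) (by omega) l hl
    · intro t ht
      refine (hq.2.2 (i + t) (by omega)).trans ?_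
      omega
    · rw [if_neg (by omega)]
      congr 1; omega
    · intro l hl
      split_ifs with h
      · rcases hrin l h with h | ⟨t, ht, h⟩
        · exact Or.inl (Or.inl h)
        · exact Or.inr ⟨t, by omega, h⟩
      · exact Or.inl (Or.inr ⟨_, by omega, by omega, rfl⟩)
  -- backward paths
  have hbwd : ∀ k, i < k → k ≤ b → ∃ (r' : ℕ → V), AP G M r' (a + b - 1 - k) ∧ r' 0 = p 0 ∧
      r' (a + b - 1 - k) = q k ∧ ∀ l, l ≤ a + b - 1 - k → r' l ∈ U ∪ verts p a := by
    intro k hk hkb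
    by_cases hkb' : k = b
    · subst hkb'
      rw [show a + k - 1 - k = a - 1 by omega]
      exact ⟨p, hp.trunc (by omega), rfl, e1, fun l hl => Or.inr ⟨l, by omega, rfl⟩⟩
    rw [show a + b - 1 - k = a + (b - 1 - k) by omega]
    refine ⟨_, AP.glue (g := fun t => q (b - 1 - t)) (m := b - 1 - k) hp (by simp [e2])
      ?_ ?_ ?_ ?_, by simp, ?_, ?_⟩
    · intro t ht
      have := (hq.1 (b - 1 - (t + 1)) (by omega)).symm
      rwa [show b - 1 - (t + 1) + 1 = b - 1 - t by omega] at this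
    · intro t ht t' ht' e
      have := hq.2.1 (b - 1 - t) (by omega) (b - 1 - t') (by omega) e
      omega
    · intro t ht1 ht2 l hl e
      exact hmax (b - 1 - t) (by omega) (by omega) ⟨l, hl, e.symm⟩
    · intro t ht
      have := hq.2.2 (b - 1 - (t + 1)) (by omega)
      rw [show b - 1 - (t + 1) + 1 = b - 1 - t by omega, Sym2.eq_swap] at this
      refine this.trans ?_
      omega
    · by_cases hk1 : k = b - 1
      · subst hk1
        simp [e2]
      · rw [if_neg (by omega)]
        congr 1; omega
    · intro l hl
      split_ifs with h
      · exact Or.inr ⟨l, h, rfl⟩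
      · exact Or.inl (Or.inr ⟨_, by omega, by omega, rfl⟩)
  refine ⟨U, ?_, Or.inr ⟨b, by omega, le_rfl, rfl⟩, Or.inr ⟨b - 1, by omega, by omega, rfl⟩,
    ?_, ?_⟩
  · rintro u (h | ⟨k, hk, hkb, h⟩)
    · obtain ⟨t, ht, h⟩ := hU' h
      exact ⟨t, by omega, h⟩
    · exact ⟨k, hkb, h⟩
  · obtain ⟨r', h1, h2, h3, h4⟩ := hfwd b (by omega) le_rfl
    exact ⟨r', _, h1, h2, h3, by omega, by omega, h4⟩
  · rintro z (hz | ⟨k, hk, hkb, rfl⟩)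
    · exact (hgood z hz).mono (Set.union_subset_union_left _ Set.subset_union_left) le_rfl
    · obtain ⟨r', h1, h2, h3, h4⟩ := hfwd k hk hkb
      obtain ⟨r'', k1, k2, k3, k4⟩ := hbwd k hk hkb
      exact ⟨r', _, r'', _, h1, k1, h2, k2, h3, k3, by omega, h4, k4, by omega⟩

theorem toFun {G : SimpleGraph V} {M : Set (Sym2 V)} {p : List V} (hp : IsAltPath G M p) (x : V) :
    AP G M (fun i => p.getD i x) (p.length - 1) := by
  obtain ⟨h0, h1, h2, h3⟩ := hp
  have hl : 0 < p.length := List.length_pos_of_ne_nil h0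
  refine ⟨?_, ?_, ?_⟩
  · intro i hi
    have := List.isChain_iff_getElem.1 h1 i (by omega)
    simpa [List.getD_eq_getElem?_getD, List.getElem?_eq_getElem (show i < p.length by omega),
      List.getElem?_eq_getElem (show i + 1 < p.length by omega)] using this
  · intro i hi j hj e
    simp only [List.getD_eq_getElem?_getD, List.getElem?_eq_getElem (show i < p.length by omega),
      List.getElem?_eq_getElem (show j < p.length by omega), Option.getD_some] at e
    exact (h2.getElem_inj_iff).1 e
  · intro i hi
    have := h3 i (by omega)
    simpa [List.getD_eq_getElem?_getD, List.getElem?_eq_getElem (show i < p.length by omega),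
      List.getElem?_eq_getElem (show i + 1 < p.length by omega)] using this

theorem toList {G : SimpleGraph V} {M : Set (Sym2 V)} {f : ℕ → V} {n : ℕ} (h : AP G M f n) :
    IsAltPathFrom G M (f 0) (f n) ((List.range (n + 1)).map f) := by
  refine ⟨⟨by simp, ?_, ?_, ?_⟩, ?_, ?_⟩
  · refine List.isChain_iff_getElem.2 ?_
    intro i hi
    simp at hi
    simpa using h.1 i (by omega)
  · refine List.Nodup.map_on ?_ List.nodup_range
    intro i hi j hj e
    simp at hi hj
    exact h.2.1 i (by omega) j (by omega) e
  · intro i hi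
    simp at hi
    simpa using h.2.2 i (by omega)
  · simp [List.range_succ_eq_map]
  · simp [List.range_succ]

theorem end_even {G : SimpleGraph V} {M : Set (Sym2 V)} {p p₀ : List V} {a b : V}
    (hp : IsAltPath G M p) (h : p = p₀ ++ [a, b]) (hab : s(a, b) ∈ M) (x : V) :
    2 ≤ p.length - 1 ∧ (p.length - 1) % 2 = 0 ∧ p.getD (p.length - 1 - 1) x = a ∧
      p.getD (p.length - 1) x = b := by
  subst h
  have h3 := hp.2.2.2 p₀.length (by simp)
  simp at h3
  have := h3.1 hab
  refine ⟨by simp; omega, by simp; omega, by simp, by simp⟩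

/-- (Intertwined paths lemma.)  Suppose `p` and `q` are alternating paths both starting
at `x`, ending in the same matched edge `vw` but from different directions (`p` ends
with the step `v, w` and `q` ends with the step `w, v`).  Then there is a set `U` of
vertices of `q` containing `v` and `w` such that every `z ∈ U` is joined to `x` by two
alternating paths of different length-parities, lying entirely in `U` together with the
vertices of `p`, whose lengths sum to at most `|q| + 2|p| − 3`. -/
theorem intertwined_paths (G : SimpleGraph V) (M : Set (Sym2 V))
    (hM : IsMatching G M) (x v w : V) (p q : List V)
    (hp : IsAltPath G M p) (hq : IsAltPath G M q)
    (hpx : p.head? = some x) (hqx : q.head? = some x)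
    (hvw : s(v, w) ∈ M)
    (hpend : ∃ p₀ : List V, p = p₀ ++ [v, w])
    (hqend : ∃ q₀ : List V, q = q₀ ++ [w, v]) :
    ∃ U : Set V, (∀ u ∈ U, u ∈ q) ∧ v ∈ U ∧ w ∈ U ∧
      ∀ z ∈ U, ∃ r₁ r₂ : List V,
        IsAltPathFrom G M x z r₁ ∧ IsAltPathFrom G M x z r₂ ∧
        pathLen r₁ % 2 ≠ pathLen r₂ % 2 ∧
        (∀ u ∈ r₁, u ∈ U ∨ u ∈ p) ∧ (∀ u ∈ r₂, u ∈ U ∨ u ∈ p) ∧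
        pathLen r₁ + pathLen r₂ ≤ pathLen q + 2 * pathLen p - 3 := by
  obtain ⟨p₀, hp₀⟩ := hpend
  obtain ⟨q₀, hq₀⟩ := hqend
  obtain ⟨ha, ha2, e1, e2⟩ := end_even hp hp₀ hvw x
  obtain ⟨hb, hb2, e3, e4⟩ := end_even hq hq₀ (by rwa [Sym2.eq_swap]) x
  have hp0 : p.getD 0 x = x := by
    rw [List.head?_eq_getElem?] at hpx
    simp [List.getD_eq_getElem?_getD, hpx]
  have hq0 : q.getD 0 x = x := by
    rw [List.head?_eq_getElem?] at hqx
    simp [List.getD_eq_getElem?_getD, hqx]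
  have hmem : ∀ (l : List V), 2 ≤ l.length - 1 → ∀ u ∈ verts (fun i => l.getD i x) (l.length - 1),
      u ∈ l := by
    rintro l hl u ⟨k, hk, rfl⟩
    simp [List.getD_eq_getElem?_getD, List.getElem?_eq_getElem (show k < l.length by omega)]
  obtain ⟨U, hU1, hU2, hU3, -, hg⟩ := main_fun G M hM (q.length - 1) (p.length - 1)
    (fun i => p.getD i x) (fun i => q.getD i x) (toFun hp x) (toFun hq x)
    (by simp only [hp0, hq0]) ha hb ha2 hb2 (by simp only [e1, e4]) (by simp only [e2, e3])
  simp only [e4, e3, hp0] at hU2 hU3 hg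
  refine ⟨U, fun u hu => hmem q hb u (hU1 hu), hU2, hU3, ?_⟩
  intro z hz
  obtain ⟨r₁, n₁, r₂, n₂, a1, a2, a3, a4, a5, a6, a7, a8, a9, a10⟩ := hg z hz
  have t1 := toList a1
  have t2 := toList a2
  rw [a3, a5] at t1
  rw [a4, a6] at t2
  refine ⟨_, _, t1, t2, by simpa [pathLen] using a7, ?_, ?_, by simpa [pathLen] using a10⟩
  · intro u hu
    simp only [List.mem_map, List.mem_range] at hu
    obtain ⟨k, hk, rfl⟩ := hu
    exact (a8 k (by omega)).imp id (hmem p ha _)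
  · intro u hu
    simp only [List.mem_map, List.mem_range] at hu
    obtain ⟨k, hk, rfl⟩ := hu
    exact (a9 k (by omega)).imp id (hmem p ha _)

end PaperPM
end

section
/- Let G be a simple graph with a matching M and let S be a set of M-unmatched vertices. If x, y ∈ T_n ∪ S and xy is an edge of G, then x ∈ B_{n+1}, or y ∈ B_{n+1}, or there is an augmenting path from S of length at most 2n + 1. -/
open scoped Classical

namespace PaperPM

variable {V : Type*}

/-- An augmenting path from the set `S`: an alternating path of odd length starting at
a vertex of `S` and ending at an `M`-unmatched vertex. -/
def IsAugPathFrom (G : SimpleGraph V) (M : Set (Sym2 V)) (S : Set V) (p : List V) : Prop :=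
  IsAltPath G M p ∧ Odd (pathLen p) ∧
    (∃ x ∈ S, p.head? = some x) ∧ ∃ y, p.getLast? = some y ∧ ¬ Matched M y

/-- `H̃ n`: the vertices reachable from `S` by an odd alternating path of length at
most `2n`. -/
def Htilde (G : SimpleGraph V) (M : Set (Sym2 V)) (S : Set V) (n : ℕ) : Set V :=
  {v | ∃ x ∈ S, ∃ p : List V, IsAltPathFrom G M x v p ∧ Odd (pathLen p) ∧ pathLen p ≤ 2 * n}

/-- `T̃ n`: the vertices reachable from `S` by an even alternating path of length
between `2` and `2n`. -/
def Ttilde (G : SimpleGraph V) (M : Set (Sym2 V)) (S : Set V) (n : ℕ) : Set V :=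
  {v | ∃ x ∈ S, ∃ p : List V, IsAltPathFrom G M x v p ∧ Even (pathLen p) ∧
    2 ≤ pathLen p ∧ pathLen p ≤ 2 * n}

/-- `B n = H̃ n ∩ T̃ n`. -/
def Bset (G : SimpleGraph V) (M : Set (Sym2 V)) (S : Set V) (n : ℕ) : Set V :=
  Htilde G M S n ∩ Ttilde G M S n

/-- `T n = T̃ n \ H̃ n`. -/
def Tset (G : SimpleGraph V) (M : Set (Sym2 V)) (S : Set V) (n : ℕ) : Set V :=
  Ttilde G M S n \ Htilde G M S n

/-- `x` is tough at time `n`: `x ∈ T n ∪ S`, `x` has a neighbour in `B n`, and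
`x ∉ H̃ (n+1)`. -/
def Tough (G : SimpleGraph V) (M : Set (Sym2 V)) (S : Set V) (n : ℕ) (x : V) : Prop :=
  x ∈ Tset G M S n ∪ S ∧ (∃ y ∈ Bset G M S n, G.Adj x y) ∧ x ∉ Htilde G M S (n + 1)

/-- The age of `x` at time `n`: `n - min {k : x ∈ T k ∪ S}`. -/
noncomputable def age (G : SimpleGraph V) (M : Set (Sym2 V)) (S : Set V) (n : ℕ) (x : V) : ℕ :=
  n - sInf {k : ℕ | x ∈ Tset G M S k ∪ S}

/-- `D` has the descendent property with respect to `x` at time `n`: every `y ∈ D` is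
joined to `x` by an odd alternating path `p` and an even alternating path `q`, both with
all vertices in `D ∪ {x}`, with `|p| + |q| ≤ 2·age(x) + 1`. -/
def DescProp (G : SimpleGraph V) (M : Set (Sym2 V)) (S : Set V) (n : ℕ) (x : V)
    (D : Set V) : Prop :=
  ∀ y ∈ D, ∃ p q : List V,
    IsAltPathFrom G M x y p ∧ Odd (pathLen p) ∧
    IsAltPathFrom G M x y q ∧ Even (pathLen q) ∧
    (∀ u ∈ p, u ∈ insert x D) ∧ (∀ u ∈ q, u ∈ insert x D) ∧
    pathLen p + pathLen q ≤ 2 * age G M S n x + 1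

/-- The family of `x` at time `n`: the union of all sets with the descendent property
with respect to `x` at time `n`. -/
def family (G : SimpleGraph V) (M : Set (Sym2 V)) (S : Set V) (n : ℕ) (x : V) : Set V :=
  ⋃₀ {D : Set V | DescProp G M S n x D}

theorem aux_take {G : SimpleGraph V} {M : Set (Sym2 V)} {a x : V} {p : List V}
    (hp : IsAltPathFrom G M a x p) (i : ℕ) (hi : i < p.length) :
    IsAltPathFrom G M a (p[i]) (p.take (i + 1)) ∧ pathLen (p.take (i + 1)) = i := by
  obtain ⟨⟨h0, h1, h2, h3⟩, h4, h5⟩ := hp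
  refine ⟨⟨⟨?_, ?_, ?_, ?_⟩, ?_, ?_⟩, ?_⟩
  · simp [h0]
  · exact List.IsChain.take h1 _
  · exact h2.sublist (List.take_sublist _ _)
  · intro j hj
    have : j + 1 < p.length := by
      simp at hj; omega
    simpa using h3 j this
  · simp [List.head?_take, h4]
  · rw [List.getLast?_eq_getElem?]
    have e : (List.take (i + 1) p).length = i + 1 := by simp; omega
    rw [e]
    simp [hi]
  · simp [pathLen]; omega

theorem aux_snoc {G : SimpleGraph V} {M : Set (Sym2 V)} {a x y : V} {p : List V}
    (hp : IsAltPathFrom G M a x p) (he : Even (pathLen p)) (hxy : G.Adj x y)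
    (hm : s(x, y) ∉ M) (hy : y ∉ p) :
    IsAltPathFrom G M a y (p ++ [y]) ∧ pathLen (p ++ [y]) = pathLen p + 1 := by
  obtain ⟨⟨h0, h1, h2, h3⟩, h4, h5⟩ := hp
  have hl : 0 < p.length := List.length_pos_iff.2 h0
  refine ⟨⟨⟨by simp, ?_, ?_, ?_⟩, ?_, by simp⟩, ?_⟩
  · refine List.IsChain.append h1 (by simp) ?_
    intro u hu v hv
    simp [h5] at hu hv
    subst hu hv
    exact hxy
  · rw [List.nodup_append]
    refine ⟨h2, by simp, ?_⟩
    intro u hu v hv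
    simp at hv
    rintro rfl
    exact hy (hv ▸ hu)
  · intro j hj
    by_cases h : j + 1 < p.length
    · rw [List.getElem_append_left h, List.getElem_append_left (by omega)]
      exact h3 j h
    · have hj' : j + 1 = p.length := by simp at hj; omega
      have e1 : (p ++ [y])[j + 1] = y := by simp [hj']
      have e2 : (p ++ [y])[j]'(by omega) = x := by
        rw [List.getElem_append_left (by omega)]
        rw [List.getLast?_eq_getElem?, List.getElem?_eq_some_iff] at h5
        obtain ⟨_, h5⟩ := h5
        rw [← h5]; congr 1; omega
      rw [e1, e2]
      unfold pathLen at he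
      have : j % 2 = 0 := by
        rw [Nat.even_iff] at he; rw [← he]; congr 1; omega
      simp [hm, this]
  · cases p <;> simp_all
  · simp [pathLen]; omega

theorem aux_single {G : SimpleGraph V} {M : Set (Sym2 V)} (a : V) :
    IsAltPathFrom G M a a [a] := by
  refine ⟨⟨by simp, List.isChain_singleton _, by simp, ?_⟩, by simp, by simp⟩
  intro i h
  simp at h

theorem aux_mono {G : SimpleGraph V} {M : Set (Sym2 V)} {S : Set V} {n : ℕ} {v : V}
    (h : v ∈ Ttilde G M S n) : v ∈ Ttilde G M S (n + 1) := by
  obtain ⟨s, hs, p, hp, he, h2, hn⟩ := h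
  exact ⟨s, hs, p, hp, he, h2, by omega⟩

theorem aux_S {G : SimpleGraph V} {M : Set (Sym2 V)} {S : Set V}
    (hS : ∀ v ∈ S, ¬ Matched M v) (n : ℕ) (x y : V)
    (hx : x ∈ S) (hy : y ∈ Tset G M S n ∪ S) (hxy : G.Adj x y) :
    y ∈ Bset G M S (n + 1) ∨
      ∃ p : List V, IsAugPathFrom G M S p ∧ pathLen p ≤ 2 * n + 1 := by
  have hm : s(x, y) ∉ M := fun h => hS x hx ⟨_, h, by simp⟩
  obtain ⟨h1, h2⟩ := aux_snoc (aux_single (G := G) (M := M) x) (by simp [pathLen]) hxy hm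
    (by simpa using hxy.ne')
  have h2' : pathLen ([x] ++ [y]) = 1 := by simp [pathLen]
  rcases hy with hy | hy
  · exact Or.inl ⟨⟨x, hx, _, h1, by rw [h2']; exact odd_one, by omega⟩, aux_mono hy.1⟩
  · exact Or.inr ⟨_, ⟨h1.1, by rw [h2']; exact odd_one, ⟨x, hx, h1.2.1⟩, y, h1.2.2, hS y hy⟩,
      by omega⟩

/-- If `x, y ∈ T n ∪ S` and `xy` is an edge, then `x ∈ B (n+1)`, or `y ∈ B (n+1)`, or
there is an augmenting path from `S` of length at most `2n + 1`. -/
theorem tail_tail_edge (G : SimpleGraph V) (M : Set (Sym2 V)) (S : Set V)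
    (hM : IsMatching G M) (hS : ∀ v ∈ S, ¬ Matched M v) (n : ℕ) (x y : V)
    (hx : x ∈ Tset G M S n ∪ S) (hy : y ∈ Tset G M S n ∪ S) (hxy : G.Adj x y) :
    x ∈ Bset G M S (n + 1) ∨ y ∈ Bset G M S (n + 1) ∨
      ∃ p : List V, IsAugPathFrom G M S p ∧ pathLen p ≤ 2 * n + 1 := by
  rcases hx with hx | hx
  swap
  · exact Or.inr (aux_S hS n x y hx hy hxy)
  rcases hy with hy | hy
  swap
  · rcases aux_S hS n y x hy (Or.inl hx) hxy.symm with h | h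
    · exact Or.inl h
    · exact Or.inr (Or.inr h)
  obtain ⟨s, hs, p, hp, he, hl, hn⟩ := hx.1
  -- y is not at an odd position of p
  have hodd : ∀ i (hi : i < p.length), p[i] = y → Even i := by
    intro i hi hiy
    by_contra hne
    obtain ⟨h1, h2⟩ := aux_take hp i hi
    refine hy.2 ⟨s, hs, _, hiy ▸ h1, ?_, ?_⟩
    · rw [h2]; exact Nat.not_even_iff_odd.1 hne
    · rw [h2]; unfold pathLen at hn; omega
  have hlast : ∃ h : p.length - 1 < p.length, p[p.length - 1] = x := by
    have h5 := hp.2.2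
    rwa [List.getLast?_eq_getElem?, List.getElem?_eq_some_iff] at h5
  obtain ⟨hlt, hlast⟩ := hlast
  have hlen : pathLen p = p.length - 1 := rfl
  have hm : s(x, y) ∉ M := by
    intro hm
    have h3 := hp.1.2.2.2 (p.length - 2) (by omega)
    have e1 : p[p.length - 2 + 1]'(by omega) = x := by
      rw [← hlast]; congr 1; omega
    rw [e1] at h3
    rw [Nat.even_iff] at he
    have hmem := h3.2 (by omega)
    have heq := hM.2 _ hm _ hmem x (by simp) (by simp)
    rw [Sym2.eq_swap, Sym2.congr_left] at heq
    have := hodd (p.length - 2) (by omega) heq.symm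
    rw [Nat.even_iff] at this
    omega
  by_cases hyp : y ∈ p
  · left
    obtain ⟨i, hi, hiy⟩ := List.mem_iff_getElem.1 hyp
    have hev := hodd i hi hiy
    obtain ⟨h1, h2⟩ := aux_take hp i hi
    rw [hiy] at h1
    have hne : i ≠ p.length - 1 := by
      rintro rfl
      exact hxy.ne (hlast.symm.trans hiy)
    have hxn : x ∉ p.take (i + 1) := by
      intro hxt
      obtain ⟨j, hj, hjx⟩ := List.mem_iff_getElem.1 hxt
      have hj' : j < i + 1 := by simp at hj; omega
      rw [List.getElem_take, ← hlast] at hjx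
      have := (hp.1.2.2.1.getElem_inj_iff).1 hjx
      omega
    obtain ⟨h3, h4⟩ := aux_snoc h1 (h2.symm ▸ hev) hxy.symm (by rwa [Sym2.eq_swap]) hxn
    refine ⟨⟨s, hs, _, h3, ?_, ?_⟩, aux_mono hx.1⟩
    · rw [h4, h2]; exact hev.add_one
    · rw [h4, h2]; omega
  · right; left
    obtain ⟨h3, h4⟩ := aux_snoc hp he hxy hm hyp
    refine ⟨⟨s, hs, _, h3, ?_, ?_⟩, aux_mono hy.1⟩
    · rw [h4]; exact he.add_one
    · rw [h4]; omega

end PaperPM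
end

section
/- Let G be a simple graph with a matching M and let S be a set of M-unmatched vertices. If x is tough at time n and xy is a tough edge (i.e., y ∈ B_n is a neighbour of x), then y belongs to the family F_n(x). In particular, every tough vertex has a nonempty family. -/
open scoped Classical

namespace PaperPM

variable {V : Type*}

theorem alt_iff (G : SimpleGraph V) (M : Set (Sym2 V)) (p : List V) :
    IsAltPath G M p ↔ p ≠ [] ∧ p.Nodup ∧ ∀ (i : ℕ) (h : i + 1 < p.length),
      G.Adj (p[i]'(Nat.lt_of_succ_lt h)) (p[i + 1]'h) ∧
      (s(p[i]'(Nat.lt_of_succ_lt h), p[i + 1]'h) ∈ M ↔ i % 2 = 1) := by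
  unfold IsAltPath
  constructor
  · rintro ⟨h1, h2, h3, h4⟩
    exact ⟨h1, h3, fun i h => ⟨List.isChain_iff_getElem.1 h2 i h, h4 i h⟩⟩
  · rintro ⟨h1, h3, h4⟩
    exact ⟨h1, List.isChain_iff_getElem.2 (fun i h => (h4 i h).1), h3, fun i h => (h4 i h).2⟩

theorem alt_take {G : SimpleGraph V} {M : Set (Sym2 V)} {p : List V} {x : V}
    (hp : IsAltPath G M p) (hx : p.head? = some x) (i : ℕ) (hi : i < p.length) :
    IsAltPathFrom G M x p[i] (p.take (i + 1)) ∧ pathLen (p.take (i + 1)) = i := by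
  rw [alt_iff] at hp
  obtain ⟨h1, h2, h3⟩ := hp
  refine ⟨⟨(alt_iff _ _ _).2 ⟨?_, h2.sublist (List.take_sublist _ _), ?_⟩, ?_, ?_⟩, ?_⟩
  · simpa using h1
  · intro j hj
    have := h3 j (by simp at hj; omega)
    simpa using this
  · cases p <;> simp_all
  · rw [List.getLast?_eq_getElem?]
    have : (p.take (i+1)).length - 1 = i := by simp; omega
    rw [this]
    simp [hi]
  · simp [pathLen]; omega

theorem alt_drop {G : SimpleGraph V} {M : Set (Sym2 V)} {p : List V}
    (hp : IsAltPath G M p) (i : ℕ) (hi : i < p.length) (he : i % 2 = 0) :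
    IsAltPath G M (p.drop i) := by
  rw [alt_iff] at hp ⊢
  obtain ⟨h1, h2, h3⟩ := hp
  refine ⟨by simpa using hi, h2.sublist (List.drop_sublist _ _), ?_⟩
  intro j hj
  have := h3 (i + j) (by simp at hj; omega)
  simp only [List.getElem_drop]
  have e : (i + j) % 2 = j % 2 := by omega
  rw [e] at this
  exact this

theorem alt_snoc {G : SimpleGraph V} {M : Set (Sym2 V)} {p : List V} {x y : V}
    (hp : IsAltPath G M p) (hy : p.getLast? = some y) (hxp : x ∉ p) (ha : G.Adj x y)
    (hxy : s(x, y) ∉ M) (he : p.length % 2 = 1) :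
    IsAltPath G M (p ++ [x]) := by
  rw [alt_iff] at hp ⊢
  obtain ⟨h1, h2, h3⟩ := hp
  refine ⟨by simp, ?_, ?_⟩
  · rw [List.nodup_append]
    refine ⟨h2, by simp, ?_⟩
    rintro a ha b hb rfl
    simp at hb
    exact hxp (hb ▸ ha)
  intro j hj
  simp at hj
  by_cases hjl : j + 1 < p.length
  · have := h3 j hjl
    rw [List.getElem_append_left hjl, List.getElem_append_left (by omega)]
    exact this
  · have hj' : j + 1 = p.length := by omega
    rw [List.getLast?_eq_getElem?, ← hj'] at hy
    have hy' : p[j]'(by omega) = y := by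
      rw [List.getElem?_eq_getElem (by omega)] at hy
      simpa using hy
    rw [List.getElem_append_left (by omega), List.getElem_append_right (by omega)]
    simp only [hy', List.getElem_singleton]
    refine ⟨ha.symm, ?_⟩
    rw [Sym2.eq_swap]
    constructor
    · intro h; exact absurd h hxy
    · intro h; omega

theorem alt_rev {G : SimpleGraph V} {M : Set (Sym2 V)} {r : List V} {x y : V}
    (hp : IsAltPath G M (x :: r)) (hy : (x :: r).getLast? = some y) (ha : G.Adj x y)
    (hxy : s(x, y) ∉ M) (he : r.length % 2 = 0) :
    IsAltPath G M (x :: r.reverse) := by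
  rw [alt_iff] at hp ⊢
  obtain ⟨h1, h2, h3⟩ := hp
  refine ⟨by simp, by simpa using h2, ?_⟩
  intro j hj
  simp at hj
  rw [List.getLast?_eq_getElem?] at hy
  rcases j with _ | j
  · have : r[r.length - 1]'(by omega) = y := by
      obtain ⟨m, hm⟩ : ∃ m, r.length = m + 1 := ⟨r.length - 1, by omega⟩
      simp only [List.length_cons, hm, Nat.add_sub_cancel, List.getElem?_cons_succ] at hy
      simp only [hm, Nat.add_sub_cancel]
      rw [List.getElem?_eq_getElem (by omega)] at hy
      simpa using hy
    simp only [List.getElem_cons_succ, List.getElem_cons_zero, List.getElem_reverse,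
      Nat.sub_zero, this]
    exact ⟨ha, by simp [hxy]⟩
  · have := h3 (r.length - 1 - (j + 1) + 1) (by simp; omega)
    simp only [List.getElem_cons_succ, List.getElem_reverse] at this ⊢
    have e : r.length - 1 - (j + 1) + 1 = r.length - 1 - j := by omega
    simp only [e] at this
    refine ⟨this.1.symm, ?_⟩
    rw [Sym2.eq_swap, this.2]
    omega

theorem main_mem (G : SimpleGraph V) (M : Set (Sym2 V)) (S : Set V)
    (hM : IsMatching G M) (n : ℕ) (x y : V)
    (hx : Tough G M S n x) (hy : y ∈ Bset G M S n) (hxy : G.Adj x y) :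
    y ∈ family G M S n x := by
  obtain ⟨-, s, hs, Q, ⟨hQ, hQs, hQy⟩, hev, h2, h2n⟩ := hy
  obtain ⟨-, -, hxH⟩ := hx
  have hodd : ∀ (i : ℕ) (hi : i < Q.length), Q[i] = x → i % 2 = 0 := by
    intro i hi hix
    by_contra hc
    obtain ⟨h, hl⟩ := alt_take hQ hQs i hi
    rw [hix] at h
    refine hxH ⟨s, hs, _, h, ?_, ?_⟩
    · rw [hl, Nat.odd_iff]; omega
    · rw [hl]; unfold pathLen at h2n; omega
  have hlen : Q.length = pathLen Q + 1 := by unfold pathLen at h2 ⊢; omega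
  have hlast : Q[Q.length - 1]'(by omega) = y := by
    rw [List.getLast?_eq_getElem?, List.getElem?_eq_getElem (by omega)] at hQy
    simpa using hQy
  rw [Nat.even_iff] at hev
  have hxyM : s(x, y) ∉ M := by
    intro hm
    have h3 := ((alt_iff _ _ _).1 hQ).2.2 (Q.length - 2) (by omega)
    have e : Q.length - 2 + 1 = Q.length - 1 := by omega
    simp only [e, hlast] at h3
    have h4 := h3.2.2 (by omega)
    have h5 := hM.2 _ h4 _ hm y (by simp) (by simp)
    have h6 : Q[Q.length - 2]'(by omega) = x := by
      rw [Sym2.eq_iff] at h5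
      rcases h5 with h | h
      · exact h.1
      · exact absurd h.2.symm hxy.ne
    have := hodd _ _ h6
    omega
  have hxQ : x ∈ Q := by
    by_contra hxQ
    refine hxH ⟨s, hs, Q ++ [x], ⟨alt_snoc hQ hQy hxQ hxy hxyM (by omega), ?_, by simp⟩, ?_, ?_⟩
    · cases Q <;> simp_all
    · rw [Nat.odd_iff]; simp only [pathLen, List.length_append, List.length_singleton]; omega
    · simp only [pathLen, List.length_append, List.length_singleton]; omega
  obtain ⟨i, hi, hix⟩ := List.getElem_of_mem hxQ
  have hi2 := hodd i hi hix
  have hage : n - i / 2 ≤ age G M S n x := by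
    unfold age
    apply Nat.sub_le_sub_left
    apply Nat.sInf_le
    show x ∈ Tset G M S (i / 2) ∪ S
    by_cases h0 : i = 0
    · right
      subst h0
      cases Q
      · simp at hi
      · simp_all
    · left
      obtain ⟨h, hl⟩ := alt_take hQ hQs i hi
      rw [hix] at h
      refine ⟨⟨s, hs, _, h, ?_, ?_, ?_⟩, ?_⟩
      · rw [hl, Nat.even_iff]; omega
      · omega
      · omega
      · rintro ⟨t, ht, p, h1, h2', h3⟩
        exact hxH ⟨t, ht, p, h1, h2', by omega⟩
  have hq := alt_drop hQ i hi hi2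
  have hql : (Q.drop i).getLast? = some y := by
    rw [List.getLast?_drop, if_neg (by omega), hQy]
  have hqe : Q.drop i = x :: Q.drop (i + 1) := by
    rw [← hix]; exact List.drop_eq_getElem_cons hi
  have hrl : (Q.drop (i + 1)).length = Q.length - (i + 1) := by simp
  rw [hqe] at hq hql
  generalize Q.drop (i + 1) = r at hq hql hrl
  have hrev := alt_rev hq hql hxy hxyM (by omega)
  have hyr : y ∈ r := by
    have := List.mem_of_getLast? hql
    rcases List.mem_cons.1 this with h | h
    · exact absurd h.symm hxy.ne
    · exact h
  refine Set.mem_sUnion.2 ⟨{u | u ∈ r}, ?_, hyr⟩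
  intro u hu
  obtain ⟨j, hj, hju⟩ := List.getElem_of_mem (show u ∈ r from hu)
  obtain ⟨ha, hal⟩ := alt_take hq (x := x) rfl (j + 1) (by simpa using hj)
  obtain ⟨hb, hbl⟩ := alt_take hrev (x := x) rfl (r.length - 1 - j + 1) (by simp; omega)
  have hju' : r[r.length - 1 - (r.length - 1 - j)]'(by omega) = u := by
    simp only [show r.length - 1 - (r.length - 1 - j) = j by omega, hju]
  simp only [List.getElem_cons_succ, List.getElem_reverse, hju, hju'] at ha hb
  have ma : ∀ v ∈ (x :: r).take (j + 1 + 1), v ∈ insert x {u | u ∈ r} := by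
    intro v hv
    have := List.mem_of_mem_take hv
    simpa using this
  have mb : ∀ v ∈ (x :: r.reverse).take (r.length - 1 - j + 1 + 1), v ∈ insert x {u | u ∈ r} := by
    intro v hv
    have := List.mem_of_mem_take hv
    simpa using this
  by_cases hpar : j % 2 = 0
  · refine ⟨_, _, ha, ?_, hb, ?_, ma, mb, ?_⟩
    · rw [hal, Nat.odd_iff]; omega
    · rw [hbl, Nat.even_iff]; omega
    · rw [hal, hbl]; omega
  · refine ⟨_, _, hb, ?_, ha, ?_, mb, ma, ?_⟩
    · rw [hbl, Nat.odd_iff]; omega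
    · rw [hal, Nat.even_iff]; omega
    · rw [hal, hbl]; omega

/-- If `x` is tough at time `n` and `xy` is a tough edge (`y ∈ B n` is a neighbour of
`x`), then `y` belongs to the family of `x`.  In particular, every tough vertex has a
nonempty family. -/
theorem tough_edge_mem_family (G : SimpleGraph V) (M : Set (Sym2 V)) (S : Set V)
    (hM : IsMatching G M) (hS : ∀ v ∈ S, ¬ Matched M v) (n : ℕ) (x y : V)
    (hx : Tough G M S n x) (hy : y ∈ Bset G M S n) (hxy : G.Adj x y) :
    y ∈ family G M S n x ∧
      ∀ x' : V, Tough G M S n x' → (family G M S n x').Nonempty := by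
  refine ⟨main_mem G M S hM n x y hx hy hxy, fun x' hx' => ?_⟩
  obtain ⟨y', hy', h⟩ := hx'.2.1
  exact ⟨y', main_mem G M S hM n x' y' hx' hy' h⟩

end PaperPM
end

section
/- Let G be a simple graph with a matching M and let S be a set of M-unmatched vertices. For every vertex x that is tough at time n, the family F_n(x) is a subset of B_n. -/
open scoped Classical

namespace PaperPM

variable {V : Type*}

/-- Recursive form of alternating walks; `i` is the index of the first edge. -/
def AltW (G : SimpleGraph V) (M : Set (Sym2 V)) : ℕ → List V → Prop
  | _, [] => True
  | _, [_] => True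
  | i, x :: y :: l => G.Adj x y ∧ (s(x, y) ∈ M ↔ i % 2 = 1) ∧ AltW G M (i + 1) (y :: l)

theorem altW_iff (G : SimpleGraph V) (M : Set (Sym2 V)) (l : List V) : ∀ k : ℕ,
    AltW G M k l ↔ (l.IsChain G.Adj ∧ ∀ (i : ℕ) (h : i + 1 < l.length),
      (s(l[i]'(Nat.lt_of_succ_lt h), l[i + 1]'h) ∈ M ↔ (k + i) % 2 = 1)) := by
  induction l with
  | nil => intro k; simp [AltW]
  | cons x l ih =>
    intro k
    cases l with
    | nil => simp [AltW]
    | cons y l =>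
      rw [AltW, ih, List.isChain_cons_cons]
      constructor
      · rintro ⟨h1, h2, h3, h4⟩
        refine ⟨⟨h1, h3⟩, ?_⟩
        intro i h
        cases i with
        | zero => simpa using h2
        | succ i =>
          have := h4 i (by simpa using h)
          rw [show k + (i + 1) = k + 1 + i by omega]
          simpa using this
      · rintro ⟨⟨h1, h3⟩, h4⟩
        refine ⟨h1, by simpa using h4 0 (by simp), h3, ?_⟩
        intro i h
        have := h4 (i + 1) (by simpa using h)
        rw [show k + (i + 1) = k + 1 + i by omega] at this
        simpa using this

theorem altW_congr (G : SimpleGraph V) (M : Set (Sym2 V)) (l : List V) {i j : ℕ}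
    (hij : i % 2 = j % 2) (h : AltW G M i l) : AltW G M j l := by
  rw [altW_iff] at h ⊢
  refine ⟨h.1, fun a ha => (h.2 a ha).trans ?_⟩
  omega

theorem altW_append (G : SimpleGraph V) (M : Set (Sym2 V)) (z : V) (l₂ l₁ : List V) : ∀ i : ℕ,
    AltW G M i (l₁ ++ z :: l₂) ↔ AltW G M i (l₁ ++ [z]) ∧ AltW G M (i + l₁.length) (z :: l₂) := by
  induction l₁ with
  | nil => intro i; simp [AltW]
  | cons x l ih =>
    intro i
    cases l with
    | nil => simp [AltW, and_assoc]
    | cons y l =>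
      have := ih (i + 1)
      simp only [List.cons_append, AltW, List.length_cons] at this ⊢
      rw [this, show i + 1 + (l.length + 1) = i + (l.length + 1 + 1) by omega]
      tauto

theorem altW_reverse (G : SimpleGraph V) (M : Set (Sym2 V)) (l : List V) : ∀ i j : ℕ,
    (i + j + l.length) % 2 = 0 → AltW G M i l → AltW G M j l.reverse := by
  induction l with
  | nil => intro i j _ _; simp [AltW]
  | cons x l ih =>
    intro i j hij h
    cases l with
    | nil => simp [AltW]
    | cons y l =>
      obtain ⟨h1, h2, h3⟩ := h
      simp only [List.length_cons] at hij
      have h4 := ih (i + 1) j (by simp only [List.length_cons]; omega) h3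
      simp only [List.reverse_cons, List.append_assoc, List.cons_append, List.nil_append] at h4 ⊢
      rw [altW_append]
      refine ⟨h4, h1.symm, ?_, trivial⟩
      rw [Sym2.eq_swap, h2, List.length_reverse]
      omega

theorem isAltPathFrom_iff (G : SimpleGraph V) (M : Set (Sym2 V)) (x y : V) (p : List V) :
    IsAltPathFrom G M x y p ↔
      AltW G M 0 p ∧ p.Nodup ∧ p.head? = some x ∧ p.getLast? = some y := by
  unfold IsAltPathFrom IsAltPath
  rw [altW_iff]
  simp only [Nat.zero_add]
  constructor
  · rintro ⟨⟨_, a, b, c⟩, d, e⟩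
    exact ⟨⟨a, c⟩, b, d, e⟩
  · rintro ⟨⟨a, c⟩, b, d, e⟩
    refine ⟨⟨?_, a, b, c⟩, d, e⟩
    rintro rfl
    simp at d

theorem first_hit (D : Set V) (l : List V) (h : ∃ z ∈ l, z ∈ D) :
    ∃ l₁ z l₂, l = l₁ ++ z :: l₂ ∧ z ∈ D ∧ ∀ u ∈ l₁, u ∉ D := by
  induction l with
  | nil => simp at h
  | cons a l ih =>
    by_cases ha : a ∈ D
    · exact ⟨[], a, l, rfl, ha, by simp⟩
    · obtain ⟨l₁, z, l₂, rfl, hz, hl⟩ := ih (by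
        obtain ⟨z, hz, hzD⟩ := h
        rcases List.mem_cons.1 hz with rfl | hz
        · exact absurd hzD ha
        · exact ⟨z, hz, hzD⟩)
      refine ⟨a :: l₁, z, l₂, rfl, hz, ?_⟩
      intro u hu
      rcases List.mem_cons.1 hu with rfl | hu
      · exact ha
      · exact hl u hu

/-- Concatenation of an even path to `x` with a path from `x`. -/
theorem concat_path (G : SimpleGraph V) (M : Set (Sym2 V)) (D : Set V) (s x y : V)
    (r p : List V) (hr : IsAltPathFrom G M s x r) (hre : Even (pathLen r))
    (hp : IsAltPathFrom G M x y p) (hpD : ∀ u ∈ p, u ∈ insert x D) (hrD : ∀ u ∈ r, u ∉ D) :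
    ∃ t, IsAltPathFrom G M s y t ∧ pathLen t = pathLen r + pathLen p := by
  rw [isAltPathFrom_iff] at hr hp
  obtain ⟨r1, r2, r3, r4⟩ := hr
  obtain ⟨p1, p2, p3, p4⟩ := hp
  obtain ⟨r', rfl⟩ := List.getLast?_eq_some_iff.1 r4
  obtain ⟨p', rfl⟩ := List.head?_eq_some_iff.1 p3
  simp only [pathLen, List.length_append, List.length_cons, List.length_nil,
    Nat.add_sub_cancel, Nat.zero_add] at hre
  refine ⟨r' ++ x :: p', ?_, by simp [pathLen]⟩
  rw [isAltPathFrom_iff]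
  refine ⟨?_, ?_, ?_, ?_⟩
  · rw [altW_append]
    refine ⟨r1, altW_congr G M _ ?_ p1⟩
    have := Nat.even_iff.1 hre
    omega
  · rw [List.nodup_append] at r2 ⊢
    refine ⟨r2.1, p2, ?_⟩
    rintro a ha b hb rfl
    rcases hpD a hb with rfl | h
    · exact r2.2.2 a ha a (by simp) rfl
    · exact hrD a (by simp [ha]) h
  · cases r' with
    | nil => simpa using r3
    | cons a r' => simpa using r3
  · rw [List.getLast?_append, p4]; simp

/-- The family of a vertex that is tough at time `n` is a subset of `B n`. -/
theorem family_subset_Bset (G : SimpleGraph V) (M : Set (Sym2 V)) (S : Set V)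
    (hM : IsMatching G M) (hS : ∀ v ∈ S, ¬ Matched M v) (n : ℕ) (x : V)
    (hx : Tough G M S n x) :
    family G M S n x ⊆ Bset G M S n := by
  have hk := Nat.sInf_mem (s := {k : ℕ | x ∈ Tset G M S k ∪ S}) ⟨n, hx.1⟩
  have hkn : sInf {k : ℕ | x ∈ Tset G M S k ∪ S} ≤ n := Nat.sInf_le hx.1
  obtain ⟨-, -, hxH⟩ := hx
  rintro y ⟨D, hD, hy⟩
  have hD' : DescProp G M S n x D := hD
  unfold DescProp age at hD'
  generalize sInf {k : ℕ | x ∈ Tset G M S k ∪ S} = k at hk hkn hD'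
  -- an even path to `x`
  obtain ⟨s, hs, r, hr, hre, hrl⟩ : ∃ s ∈ S, ∃ r, IsAltPathFrom G M s x r ∧
      Even (pathLen r) ∧ pathLen r ≤ 2 * k := by
    rcases hk with ⟨⟨s, hs, r, hr, he, -, hl⟩, -⟩ | hxS
    · exact ⟨s, hs, r, hr, he, hl⟩
    · refine ⟨x, hxS, [x], ?_, by simp [pathLen], by simp [pathLen]⟩
      rw [isAltPathFrom_iff]
      simp [AltW]
  have hxD : x ∉ D := by
    intro hxD
    obtain ⟨p, q, hp, hpo, -⟩ := hD' x hxD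
    rw [isAltPathFrom_iff] at hp
    obtain ⟨p1, p2, p3, p4⟩ := hp
    obtain ⟨p', rfl⟩ := List.head?_eq_some_iff.1 p3
    cases p' with
    | nil => simp [pathLen] at hpo
    | cons a p' =>
      rw [List.getLast?_cons_cons] at p4
      exact (List.nodup_cons.1 p2).1 (List.mem_of_getLast? p4)
  -- even paths have length at least two
  have hq2 : ∀ z ∈ D, ∀ q, IsAltPathFrom G M x z q → Even (pathLen q) → 2 ≤ pathLen q := by
    intro z hz q hq hqe
    rw [isAltPathFrom_iff] at hq
    obtain ⟨p1, p2, p3, p4⟩ := hq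
    obtain ⟨p', rfl⟩ := List.head?_eq_some_iff.1 p3
    cases p' with
    | nil =>
      simp at p4
      exact absurd hz (p4 ▸ hxD)
    | cons a p' =>
      simp only [pathLen, List.length_cons, Nat.even_iff] at hqe ⊢
      omega
  have hrD : ∀ u ∈ r, u ∉ D := by
    by_contra hcon
    push Not at hcon
    obtain ⟨l₁, z, l₂, rfl, hz, hl⟩ := first_hit D r hcon
    obtain ⟨p, q, hp, hpo, hq, hqe, -, hqD, hlen⟩ := hD' z hz
    have hq2' := hq2 z hz q hq hqe
    have hp1 : 1 ≤ pathLen p := hpo.pos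
    rw [isAltPathFrom_iff] at hr hq
    obtain ⟨r1, r2, r3, r4⟩ := hr
    obtain ⟨q1, q2, q3, q4⟩ := hq
    have hxl : x ∉ l₁ := by
      intro hxl
      have h1 : x ∈ z :: l₂ := by
        rw [List.getLast?_append_of_ne_nil _ (by simp)] at r4
        exact List.mem_of_getLast? r4
      exact (List.nodup_append.1 r2).2.2 x hxl x h1 rfl
    have hl₂ : l₂ ≠ [] := by
      rintro rfl
      rw [List.getLast?_append_of_ne_nil _ (by simp)] at r4
      simp at r4
      exact hxD (r4 ▸ hz)
    have hl₂' : 0 < l₂.length := List.length_pos_of_ne_nil hl₂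
    have hqr := altW_reverse G M q 0 1 (by
      have := Nat.even_iff.1 hqe
      unfold pathLen at this hq2'
      omega) q1
    have hqn : q.reverse.Nodup := List.nodup_reverse.2 q2
    have hqh : q.reverse.head? = some z := by rw [List.head?_reverse, q4]
    have hql : q.reverse.getLast? = some x := by rw [List.getLast?_reverse, q3]
    have hqm : ∀ u ∈ q.reverse, u ∈ insert x D := fun u hu => hqD u (List.mem_reverse.1 hu)
    have hqlen : pathLen q = pathLen q.reverse := by simp [pathLen]
    rw [hqlen] at hqe hlen hq2'
    generalize q.reverse = t at *
    obtain ⟨t', rfl⟩ := List.head?_eq_some_iff.1 hqh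
    cases t' with
    | nil => simp [pathLen] at hq2'
    | cons w t =>
    have hzw : s(z, w) ∈ M := hqr.2.1.2 rfl
    rw [altW_append] at r1
    by_cases hpar : l₁.length % 2 = 1
    · apply hxH
      refine ⟨s, hs, l₁ ++ z :: w :: t, ?_, ?_, ?_⟩
      · rw [isAltPathFrom_iff]
        refine ⟨?_, ?_, ?_, ?_⟩
        · rw [altW_append]
          exact ⟨r1.1, altW_congr G M _ (by omega) hqr⟩
        · rw [List.nodup_append]
          refine ⟨(List.nodup_append.1 r2).1, hqn, ?_⟩
          rintro a ha b hb rfl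
          rcases hqm a hb with rfl | h
          · exact hxl ha
          · exact hl a ha h
        · cases l₁ with
          | nil => simp at hpar
          | cons a l => simpa using r3
        · rw [List.getLast?_append_of_ne_nil _ (by simp), hql]
      · simp only [pathLen, List.length_append, List.length_cons, Nat.odd_iff, Nat.even_iff]
          at hqe ⊢
        omega
      · simp only [pathLen, List.length_append, List.length_cons] at hlen hrl hp1 ⊢
        simp only [pathLen, List.length_append, List.length_cons, Nat.even_iff] at hre
        omega
    · rcases List.eq_nil_or_concat l₁ with rfl | ⟨l, w', rfl⟩
      · simp at r3
        subst r3
        exact hS _ hs ⟨_, hzw, by simp⟩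
      · have h1 := r1.1
        simp only [List.concat_eq_append, List.append_assoc, List.cons_append,
          List.nil_append, List.length_append, List.length_cons, List.length_nil] at h1 hpar
        rw [altW_append] at h1
        have hwz : s(w', z) ∈ M := h1.2.2.1.2 (by omega)
        have heq := hM.2 _ hzw _ hwz z (by simp) (by simp)
        have hww : w = w' := by
          rw [Sym2.eq_swap] at heq
          exact Sym2.congr_left.1 heq
        subst hww
        rcases hqm w (by simp) with rfl | h
        · exact hxl (by simp)
        · exact hl w (by simp) h
  obtain ⟨p, q, hp, hpo, hq, hqe, hpD, hqD, hlen⟩ := hD' y hy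
  have h2 := hq2 y hy q hq hqe
  have h1 := hpo.pos
  obtain ⟨t, ht, htl⟩ := concat_path G M D s x y r p hr hre hp hpD hrD
  obtain ⟨t', ht', htl'⟩ := concat_path G M D s x y r q hr hre hq hqD hrD
  refine ⟨⟨s, hs, t, ht, ?_, by omega⟩, ⟨s, hs, t', ht', ?_, by omega, by omega⟩⟩
  · rw [htl]; exact hre.add_odd hpo
  · rw [htl']; exact hre.add hqe

end PaperPM
end

section
/- Let G be a simple graph with a matching M and let S be a set of M-unmatched vertices. If x and y are vertices that are tough at time n, z ∈ F_n(x), and y is adjacent to z, then y = x. In other words, exactly one tough vertex is adjacent to any family. -/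
open scoped Classical

namespace PaperPM

variable {V : Type*}

def Alt (G : SimpleGraph V) (M : Set (Sym2 V)) (c : ℕ) (p : List V) : Prop :=
  ∀ (i : ℕ) (h : i + 1 < p.length), G.Adj (p[i]'(Nat.lt_of_succ_lt h)) (p[i + 1]'h) ∧
      (s(p[i]'(Nat.lt_of_succ_lt h), p[i + 1]'h) ∈ M ↔ (i + c) % 2 = 1)

theorem isAltPath_iff (G : SimpleGraph V) (M : Set (Sym2 V)) (p : List V) :
    IsAltPath G M p ↔ p ≠ [] ∧ p.Nodup ∧ Alt G M 0 p := by
  unfold IsAltPath Alt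
  have : p.Chain' G.Adj ↔ ∀ (i : ℕ) (h : i + 1 < p.length),
      G.Adj (p[i]'(Nat.lt_of_succ_lt h)) (p[i + 1]'h) := List.isChain_iff_getElem
  rw [this]
  simp only [Nat.add_zero]
  constructor
  · rintro ⟨h1, h2, h3, h4⟩
    exact ⟨h1, h3, fun i h => ⟨h2 i h, h4 i h⟩⟩
  · rintro ⟨h1, h3, h4⟩
    exact ⟨h1, fun i h => (h4 i h).1, h3, fun i h => (h4 i h).2⟩

theorem Alt.append {G : SimpleGraph V} {M : Set (Sym2 V)} {c : ℕ} {l1 l2 : List V} {w : V}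
    (h1 : Alt G M c (l1 ++ [w])) (h2 : Alt G M (c + l1.length) (w :: l2)) :
    Alt G M c (l1 ++ w :: l2) := by
  intro i h
  by_cases hi : i < l1.length
  · have := h1 i (by simp; omega)
    have e1 : (l1 ++ w :: l2)[i]'(by omega) = (l1 ++ [w])[i]'(by simp; omega) := by
      grind
    have e2 : (l1 ++ w :: l2)[i+1]'(by omega) = (l1 ++ [w])[i+1]'(by simp; omega) := by
      grind
    rw [e1, e2]; exact this
  · have hl : i - l1.length + 1 < (w :: l2).length := by
      simp at h ⊢; omega
    have := h2 (i - l1.length) hl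
    have e1 : (l1 ++ w :: l2)[i]'(by omega) = (w :: l2)[i - l1.length]'(by omega) := by
      grind
    have e2 : (l1 ++ w :: l2)[i+1]'(by omega) = (w :: l2)[i - l1.length + 1]'(by omega) := by
      grind
    have e3 : i - l1.length + (c + l1.length) = i + c := by omega
    rw [e3] at this
    rw [e1, e2]; exact this

theorem Alt.left {G : SimpleGraph V} {M : Set (Sym2 V)} {c : ℕ} {l1 l2 : List V}
    (h1 : Alt G M c (l1 ++ l2)) : Alt G M c l1 := by
  intro i h
  have := h1 i (by simp; omega)
  rw [List.getElem_append_left h, List.getElem_append_left (by omega)] at this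
  exact this

theorem Alt.reverse {G : SimpleGraph V} {M : Set (Sym2 V)} {c c' : ℕ} {p : List V}
    (h1 : Alt G M c p) (hc : (c + c' + p.length) % 2 = 0) : Alt G M c' p.reverse := by
  intro i h
  simp at h
  have := h1 (p.length - 2 - i) (by omega)
  have e1 : p.reverse[i]'(by simp; omega) = p[p.length - 2 - i + 1]'(by omega) := by
    rw [List.getElem_reverse]; congr 1; omega
  have e2 : p.reverse[i+1]'(by simp; omega) = p[p.length - 2 - i]'(by omega) := by
    rw [List.getElem_reverse]; congr 1; omega
  rw [e1, e2]
  refine ⟨this.1.symm, ?_⟩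
  rw [Sym2.eq_swap, this.2]
  omega

theorem Alt.congr {G : SimpleGraph V} {M : Set (Sym2 V)} {c c' : ℕ} {p : List V}
    (h1 : Alt G M c p) (hc : c % 2 = c' % 2) : Alt G M c' p := by
  intro i h
  refine ⟨(h1 i h).1, (h1 i h).2.trans ?_⟩
  omega

theorem IsAltPath.left {G : SimpleGraph V} {M : Set (Sym2 V)} {l1 l2 : List V} {w : V}
    (h : IsAltPath G M (l1 ++ w :: l2)) : IsAltPath G M (l1 ++ [w]) := by
  have e : l1 ++ w :: l2 = (l1 ++ [w]) ++ l2 := by simp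
  rw [e, isAltPath_iff] at h
  rw [isAltPath_iff]
  exact ⟨by simp, h.2.1.of_append_left, h.2.2.left⟩

theorem IsAltPath.join {G : SimpleGraph V} {M : Set (Sym2 V)} {l t : List V} {x : V}
    (h1 : IsAltPath G M (l ++ [x])) (he : l.length % 2 = 0) (h2 : IsAltPath G M (x :: t))
    (hd : ∀ u ∈ l, u ∉ x :: t) : IsAltPath G M (l ++ x :: t) := by
  rw [isAltPath_iff] at *
  refine ⟨by simp, ?_, h1.2.2.append (h2.2.2.congr (by omega))⟩
  refine List.Nodup.append h1.2.1.of_append_left h2.2.1 ?_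
  intro u hu hu'
  exact hd u hu hu'

theorem IsAltPath.splice {G : SimpleGraph V} {M : Set (Sym2 V)} {l m : List V} {w : V}
    (h1 : IsAltPath G M (l ++ [w])) (h2 : IsAltPath G M (m ++ [w]))
    (ho : (l.length + m.length) % 2 = 1)
    (hd : ∀ u ∈ l, u ∉ m ++ [w]) : IsAltPath G M (l ++ w :: m.reverse) := by
  rw [isAltPath_iff] at *
  have e : w :: m.reverse = (m ++ [w]).reverse := by simp
  refine ⟨by simp, ?_, h1.2.2.append ?_⟩
  · rw [e]
    refine List.Nodup.append h1.2.1.of_append_left (List.nodup_reverse.2 h2.2.1) ?_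
    intro u hu hu'
    exact hd u hu (List.mem_reverse.1 hu')
  · rw [e]
    exact h2.2.2.reverse (by simp; omega)

theorem IsAltPath.snoc {G : SimpleGraph V} {M : Set (Sym2 V)} {l : List V} {y z : V}
    (h1 : IsAltPath G M (l ++ [y])) (ha : G.Adj y z) (hm : s(y, z) ∈ M ↔ l.length % 2 = 1)
    (hz : z ∉ l ++ [y]) : IsAltPath G M ((l ++ [y]) ++ [z]) := by
  rw [isAltPath_iff] at *
  refine ⟨by simp, ?_, ?_⟩
  · refine List.Nodup.append h1.2.1 (List.nodup_singleton z) ?_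
    intro u hu hu'
    rw [List.mem_singleton] at hu'
    exact hz (hu' ▸ hu)
  · have e : (l ++ [y]) ++ [z] = l ++ y :: [z] := by simp
    rw [e]
    refine h1.2.2.append ?_
    intro i h
    simp at h
    subst h
    simpa using ⟨ha, hm⟩

theorem first_split (D : Set V) (l : List V) (h : ∃ w ∈ l, w ∈ D) :
    ∃ l1 w l2, l = l1 ++ w :: l2 ∧ w ∈ D ∧ ∀ v ∈ l1, v ∉ D := by
  induction l with
  | nil => simp at h
  | cons a l ih =>
    by_cases ha : a ∈ D
    · exact ⟨[], a, l, rfl, ha, by simp⟩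
    · have : ∃ w ∈ l, w ∈ D := by
        obtain ⟨w, hw, hwD⟩ := h
        rcases List.mem_cons.1 hw with rfl | hw
        · exact absurd hwD ha
        · exact ⟨w, hw, hwD⟩
      obtain ⟨l1, w, l2, rfl, hw, hl⟩ := ih this
      refine ⟨a :: l1, w, l2, rfl, hw, ?_⟩
      intro v hv
      rcases List.mem_cons.1 hv with rfl | hv
      · exact ha
      · exact hl v hv

theorem desc_not_mem {G : SimpleGraph V} {M : Set (Sym2 V)} {S : Set V} {n : ℕ} {x : V}
    {D : Set V} (hD : DescProp G M S n x D) : x ∉ D := by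
  intro hx
  obtain ⟨p, q, ⟨hp, hh, hl⟩, hodd, -⟩ := hD x hx
  obtain ⟨t, rfl⟩ := List.head?_eq_some_iff.1 hh
  obtain ⟨l, hl⟩ := List.getLast?_eq_some_iff.1 hl
  have hn := hp.2.2.1
  cases l with
  | nil =>
    simp at hl
    subst hl
    simp [pathLen] at hodd
  | cons a l =>
    simp at hl
    obtain ⟨rfl, rfl⟩ := hl
    simp at hn

/-- data for `w ∈ D` -/
theorem desc_data {G : SimpleGraph V} {M : Set (Sym2 V)} {S : Set V} {n : ℕ} {x : V}
    {D : Set V} (hD : DescProp G M S n x D) {w : V} (hw : w ∈ D) :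
    ∃ t m : List V, IsAltPath G M (x :: t ++ [w]) ∧ t.length % 2 = 0 ∧ (∀ u ∈ t, u ∈ D) ∧
      IsAltPath G M (x :: m ++ [w]) ∧ m.length % 2 = 1 ∧ (∀ u ∈ m, u ∈ D) ∧
      t.length + m.length + 2 ≤ 2 * age G M S n x + 1 := by
  have hxD := desc_not_mem hD
  have key : ∀ p, IsAltPathFrom G M x w p → (∀ u ∈ p, u ∈ insert x D) →
      ∃ t, p = x :: t ++ [w] ∧ (∀ u ∈ t, u ∈ D) := by
    rintro p ⟨hp, hh, hl⟩ hu
    obtain ⟨l, rfl⟩ := List.getLast?_eq_some_iff.1 hl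
    have hn := hp.2.2.1
    cases l with
    | nil =>
      simp at hh
      subst hh
      exact absurd hw hxD
    | cons a l =>
      simp at hh
      subst hh
      refine ⟨l, rfl, ?_⟩
      intro u hul
      rcases hu u (by simp [hul]) with rfl | h
      · simp [hul] at hn
      · exact h
  obtain ⟨p, q, hp, hpo, hq, hqe, hpu, hqu, hlen⟩ := hD w hw
  obtain ⟨t, rfl, ht⟩ := key p hp hpu
  obtain ⟨m, rfl, hm⟩ := key q hq hqu
  simp only [pathLen, List.length_append, List.length_cons, List.length_nil,
    Nat.odd_iff, Nat.even_iff] at hpo hqe hlen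
  exact ⟨t, m, hp.1, by omega, ht, hq.1, by omega, hm, by omega⟩

theorem desc_partner {G : SimpleGraph V} {M : Set (Sym2 V)} {S : Set V} {n : ℕ} {x : V}
    {D : Set V} (hD : DescProp G M S n x D) {w : V} (hw : w ∈ D) :
    ∃ u ∈ D, s(u, w) ∈ M := by
  obtain ⟨t, m, -, -, -, hq, hodd, hm, -⟩ := desc_data hD hw
  rcases List.eq_nil_or_concat m with rfl | ⟨m, u, rfl⟩
  · simp at hodd
  · refine ⟨u, hm u (by simp), ?_⟩
    simp at hodd
    have := (hq.2.2.2 (m.length + 1) (by simp)).2 hodd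
    simpa using this

theorem matching_partner {G : SimpleGraph V} {M : Set (Sym2 V)} (hM : IsMatching G M)
    {u v w : V} (hu : s(u, w) ∈ M) (hv : s(v, w) ∈ M) : u = v := by
  have := hM.2 _ hu _ hv w (by simp) (by simp)
  simp at this
  rcases this with h | ⟨h, h'⟩
  · exact h
  · exact h.trans h'

theorem mem_Htilde {G : SimpleGraph V} {M : Set (Sym2 V)} {S : Set V} {n : ℕ} {s w : V}
    (hs : s ∈ S) {l : List V} (h : IsAltPath G M (l ++ [w])) (hh : (l ++ [w]).head? = some s)
    (ho : l.length % 2 = 1) (hn : l.length ≤ 2 * n) : w ∈ Htilde G M S n := by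
  refine ⟨s, hs, l ++ [w], ⟨h, hh, by simp⟩, ?_, ?_⟩
  · simp [pathLen, Nat.odd_iff, ho]
  · simpa [pathLen] using hn

theorem tough_path {G : SimpleGraph V} {M : Set (Sym2 V)} {S : Set V} {n : ℕ} {x : V}
    (hx : Tough G M S n x) : ∃ s ∈ S, ∃ l : List V, IsAltPath G M (l ++ [x]) ∧
      (l ++ [x]).head? = some s ∧ l.length % 2 = 0 ∧
      l.length + 2 * age G M S n x ≤ 2 * n := by
  have hmem : n ∈ {k : ℕ | x ∈ Tset G M S k ∪ S} := hx.1
  have h1 := Nat.sInf_mem (⟨n, hmem⟩ : {k : ℕ | x ∈ Tset G M S k ∪ S}.Nonempty)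
  have h2 := Nat.sInf_le hmem
  unfold age
  set k := sInf {k : ℕ | x ∈ Tset G M S k ∪ S}
  rcases h1 with h | h
  · obtain ⟨s, hs, p, ⟨hp, hh, hl⟩, he, -, hle⟩ := h.1
    obtain ⟨l, rfl⟩ := List.getLast?_eq_some_iff.1 hl
    simp only [pathLen, List.length_append, List.length_cons, List.length_nil,
      Nat.even_iff] at he hle
    exact ⟨s, hs, l, hp, hh, by omega, by omega⟩
  · exact ⟨x, h, [], ⟨by simp, by exact List.isChain_singleton x, by simp, by simp⟩, by simp, by simp, by simp⟩

theorem avoid {G : SimpleGraph V} {M : Set (Sym2 V)} {S : Set V} (hM : IsMatching G M)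
    (hS : ∀ v ∈ S, ¬ Matched M v) {n : ℕ} {x : V} {D : Set V} (hD : DescProp G M S n x D)
    (hx : x ∉ Htilde G M S (n + 1)) {s : V} (hs : s ∈ S) {l : List V}
    (hl : IsAltPath G M (l ++ [x])) (hh : (l ++ [x]).head? = some s)
    (hlen : l.length + 2 * age G M S n x ≤ 2 * n) : ∀ w ∈ l, w ∉ D := by
  by_contra hcon
  push Not at hcon
  obtain ⟨l1, w, l2, rfl, hw, hl1⟩ := first_split D l hcon
  have hxD := desc_not_mem hD
  have hl' : IsAltPath G M (l1 ++ w :: (l2 ++ [x])) := by simpa using hl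
  have hpre := hl'.left
  obtain ⟨u, hu, huw⟩ := desc_partner hD hw
  rcases Nat.mod_two_eq_zero_or_one l1.length with he | ho
  · rcases List.eq_nil_or_concat l1 with rfl | ⟨l0, v, rfl⟩
    · simp at hh
      subst hh
      exact hS w hs ⟨_, huw, by simp⟩
    · simp at he
      have := (hpre.2.2.2 l0.length (by simp)).2 (by omega)
      simp at this
      exact hl1 v (by simp) (matching_partner hM huw this ▸ hu)
  · obtain ⟨t, m, -, -, -, hq, hodd, hm, hle⟩ := desc_data hD hw
    have hnd := hl.2.2.1
    have := hpre.splice hq (by simp; omega) (by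
      intro v hv hv'
      simp at hv'
      rcases hv' with rfl | hv' | rfl
      · exact (List.nodup_append.1 hnd).2.2 v (by simp [hv]) v (by simp) rfl
      · exact hl1 v hv (hm v hv')
      · exact hl1 v hv hw)
    apply hx
    refine mem_Htilde (l := l1 ++ w :: m.reverse) hs (by simpa using this) ?_ ?_ ?_
    · cases l1 <;> simpa using hh
    · simp; omega
    · simp at hlen ⊢; omega

/-- Exactly one tough vertex is adjacent to any family: if `x` and `y` are tough at
time `n`, `z` lies in the family of `x`, and `y` is adjacent to `z`, then `y = x`. -/
theorem unique_tough_adjacent_to_family (G : SimpleGraph V) (M : Set (Sym2 V)) (S : Set V)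
    (hM : IsMatching G M) (hS : ∀ v ∈ S, ¬ Matched M v) (n : ℕ) (x y z : V)
    (hx : Tough G M S n x) (hy : Tough G M S n y)
    (hz : z ∈ family G M S n x) (hadj : G.Adj y z) :
    y = x := by
  obtain ⟨D, hD, hzD⟩ := hz
  change DescProp G M S n x D at hD
  by_contra hne
  have hxD := desc_not_mem hD
  obtain ⟨s, hs, l, hl, hh, he, hlen⟩ := tough_path hx
  have hav := avoid hM hS hD hx.2.2 hs hl hh hlen
  have hnd := hl.2.2.1
  have hxl : x ∉ l := by
    intro h
    exact (List.nodup_append.1 hnd).2.2 x h x (by simp) rfl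
  have hyD : y ∉ D := by
    intro hyD
    obtain ⟨t, m, hp, hodd, ht, -, -, -, hle⟩ := desc_data hD hyD
    have := hl.join he hp (by
      intro u hu hu'
      simp at hu'
      rcases hu' with rfl | hu' | rfl
      · exact hxl hu
      · exact hav u hu (ht u hu')
      · exact hav u hu hyD)
    apply hy.2.2
    refine mem_Htilde (l := l ++ x :: t) hs (by simpa using this) ?_ ?_ ?_
    · cases l <;> simpa using hh
    · simp; omega
    · simp; omega
  obtain ⟨u, hu, huz⟩ := desc_partner hD hzD
  have hyz : s(y, z) ∉ M := fun h => hyD (matching_partner hM huz h ▸ hu)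
  obtain ⟨t, m, -, -, -, hq, hodd, hm, hle⟩ := desc_data hD hzD
  have hzx : z ≠ x := fun h => hxD (h ▸ hzD)
  by_cases hyl : y ∈ l
  · obtain ⟨l1, l2, rfl⟩ := List.append_of_mem hyl
    have hl' : IsAltPath G M (l1 ++ y :: (l2 ++ [x])) := by simpa using hl
    have hpre := hl'.left
    have hh1 : (l1 ++ [y]).head? = some s := by
      cases l1 <;> simpa using hh
    simp at hlen
    rcases Nat.mod_two_eq_zero_or_one l1.length with he1 | ho1
    · have h1 := hpre.snoc hadj (by simp [hyz, he1]) (by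
        intro hz
        refine hav z ?_ hzD
        simp at hz ⊢
        tauto)
      have h2 := h1.splice hq (by simp; omega) (by
        intro v hv hv'
        have hvl : v ∈ l1 ++ y :: l2 := by
          simp at hv ⊢
          tauto
        simp at hv'
        rcases hv' with rfl | hv' | rfl
        · exact hxl hvl
        · exact hav v hvl (hm v hv')
        · exact hav v hvl hzD)
      apply hx.2.2
      refine mem_Htilde (l := l1 ++ y :: z :: m.reverse) hs (by simpa using h2) ?_ ?_ ?_
      · cases l1 <;> simpa using hh
      · simp; omega
      · simp; omega
    · exact hy.2.2 (mem_Htilde hs hpre hh1 ho1 (by omega))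
  · have h1 := hl.join he hq (by
      intro v hv hv'
      simp at hv'
      rcases hv' with rfl | hv' | rfl
      · exact hxl hv
      · exact hav v hv (hm v hv')
      · exact hav v hv hzD)
    have h2 := IsAltPath.snoc (l := l ++ x :: m) (y := z) (z := y) (by simpa using h1)
      hadj.symm (by
        rw [Sym2.eq_swap]
        simp [hyz]
        omega) (by
        intro h
        simp at h
        rcases h with h | h | h | h
        · exact hyl h
        · exact hne h
        · exact hyD (hm y h)
        · exact hadj.ne h)
    apply hy.2.2
    refine mem_Htilde (l := (l ++ x :: m) ++ [z]) hs h2 ?_ ?_ ?_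
    · cases l <;> simpa using hh
    · simp; omega
    · simp; omega

end PaperPM
end
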